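/- Let χ be a linear functional on W of height -1, 0 or 1 and let λ, λ' ∈ Λ(χ) with λ' ∈ {0, p-1}. Then Ext(V_χ(λ'), V_χ(λ)), taken in the category of W-modules with p-character χ, is isomorphic to K if λ ∈ {0, 1, 2, 3, 4, p-1}, and is 0 otherwise. -/

import Mathlib

/-!
Common setup: the Witt algebra `W` over `K` (char `p > 3`) has basis
`e_{-1}, e_0, ..., e_{p-2}` with `[e_i, e_j] = (j-i) e_{i+j}` (and `e_k = 0`
outside the range), and `p`-mapping `e_i^{[p]} = δ_{i0} e_i`.  A module with
`p`-character `χ` over `W` (resp. the subalgebra `W_0 = <e_0, ..., e_{p-2}>`)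
is given by a family of endomorphisms `ρ k` (`k : ℤ`, vanishing outside
`[lo, p-2]` where `lo = -1` for `W` and `lo = 0` for `W_0`) satisfying the
bracket relations and `(ρ i)^p - δ_{i0} ρ i = χ(e_i)^p • 1`.

The Baer Ext space `Ext(N, M)` of two such modules, in the category of
modules with `p`-character `χ`, is realized concretely: an extension
`0 → M → E → N → 0` admits a linear splitting `E ≃ M ⊕ N`, under which the
action of `e_k` is `(m, n) ↦ (ρM k m + c k n, ρN k n)` for a "cocycle"
`c : ℤ → (N →ₗ M)`; the conditions for `E` to be a module with `p`-character
`χ` are the cocycle conditions below, Baer equivalence corresponds to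
differing by a coboundary, and the Baer sum / scalar action correspond to the
linear structure on cocycles.  So `Ext(N, M) ≅ cocycles / coboundaries`.
-/

set_option maxHeartbeats 1000000
set_option synthInstance.maxHeartbeats 1000000

noncomputable section

/-- The coefficient `(-1)^j · (i!/(i-j)!) · ((j+1)λ - i + j)` of the action
`e_j · v_i = (coefficient) · v_{i-j}` on the reduced Verma module; it vanishes
for `j > i` since then `Nat.descFactorial i j = 0`. -/
def wCoef (K : Type) [Field K] (lam : K) (j i : ℕ) : K :=
  (-1 : K) ^ j * (Nat.descFactorial i j : K) * (((j : K) + 1) * lam - (i : K) + (j : K))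

/-- Matrices (in the basis `v_0, ..., v_{p-1}`) of the generators `e_j`
(`j : ℤ`) acting on the reduced Verma module `V_χ(λ)`; here `c = χ(e_{-1})^p`.
`e_{-1} v_i = v_{i+1}` for `i < p-1`, `e_{-1} v_{p-1} = c v_0`, and for
`0 ≤ j ≤ p-2`, `e_j v_i = (-1)^j (i!/(i-j)!) ((j+1)λ - i + j) v_{i-j}`. -/
def vermaMat (K : Type) [Field K] (p : ℕ) (c lam : K) : ℤ → Matrix (Fin p) (Fin p) K :=
  fun j =>
    if j = -1 then
      Matrix.of fun k l =>
        if (k : ℕ) = (l : ℕ) + 1 then 1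
        else if (k : ℕ) = 0 ∧ (l : ℕ) = p - 1 then c else 0
    else if 0 ≤ j ∧ j ≤ (p : ℤ) - 2 then
      Matrix.of fun k l =>
        if (l : ℕ) = (k : ℕ) + j.toNat then wCoef K lam j.toNat (l : ℕ) else 0
    else 0

/-- The action of the basis elements `e_j` (`j : ℤ`) on the reduced Verma
module `V_χ(λ)`, with `c = χ(e_{-1})^p`. -/
def vermaRho (K : Type) [Field K] (p : ℕ) (c lam : K) : ℤ → Module.End K (Fin p → K) :=
  fun j => Matrix.toLin' (vermaMat K p c lam j)

/-- The one-dimensional `W_0`-module `K_λ`: `e_0` acts by `λ`, all other `e_j` act by `0`. -/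
def oneDimRho (K : Type) [Field K] (lam : K) : ℤ → Module.End K K :=
  fun j => if j = 0 then lam • (1 : Module.End K K) else 0

/-- The one-dimensional trivial module: every basis element acts by `0`. -/
def trivRho (K : Type) [Field K] : ℤ → Module.End K K := fun _ => 0

/-- The coefficient `(-1)^(j+1) · ((i+1)!/(i-j)!)` of the action
`e_j · u_i = (coefficient) · u_{i-j}` on the `(p-1)`-dimensional simple module `S`. -/
def sCoef (K : Type) [Field K] (j i : ℕ) : K :=
  (-1 : K) ^ (j + 1) * (Nat.descFactorial (i + 1) (j + 1) : K)

/-- Matrices (in the basis `u_0, ..., u_{p-2}`) of the generators `e_j` acting on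
the `(p-1)`-dimensional simple restricted module `S = V_0(p-1)/Soc(V_0(p-1))`. -/
def sMat (K : Type) [Field K] (p : ℕ) : ℤ → Matrix (Fin (p - 1)) (Fin (p - 1)) K :=
  fun j =>
    if j = -1 then
      Matrix.of fun k l => if (k : ℕ) = (l : ℕ) + 1 then 1 else 0
    else if 0 ≤ j ∧ j ≤ (p : ℤ) - 2 then
      Matrix.of fun k l =>
        if (l : ℕ) = (k : ℕ) + j.toNat then sCoef K j.toNat (l : ℕ) else 0
    else 0

/-- The action of the basis elements `e_j` on the simple module `S`. -/
def sRho (K : Type) [Field K] (p : ℕ) : ℤ → Module.End K (Fin (p - 1) → K) :=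
  fun j => Matrix.toLin' (sMat K p j)

section ExtSpace

variable (K : Type) [Field K] (M N : Type) [AddCommGroup M] [Module K M]
  [AddCommGroup N] [Module K N]

/-- Constraint: a cocycle vanishes outside the index range `[lo, p-2]`. -/
def suppConstraint (p : ℕ) (lo k : ℤ) : (ℤ → N →ₗ[K] M) →ₗ[K] (N →ₗ[K] M) :=
  if k < lo ∨ (p : ℤ) - 2 < k then LinearMap.proj k else 0

variable {M N}

/-- Constraint on a cocycle coming from the bracket relation
`[e_i, e_j] = (j - i) e_{i+j}`:
`(j-i) c(i+j) = ρM i ∘ c j + c i ∘ ρN j - ρM j ∘ c i - c j ∘ ρN i`. -/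
def bracketConstraint (p : ℕ) (lo : ℤ) (ρM : ℤ → Module.End K M)
    (ρN : ℤ → Module.End K N) (i j : ℤ) :
    (ℤ → N →ₗ[K] M) →ₗ[K] (N →ₗ[K] M) :=
  if lo ≤ i ∧ i ≤ (p : ℤ) - 2 ∧ lo ≤ j ∧ j ≤ (p : ℤ) - 2 then
    ((j - i : ℤ) : K) • LinearMap.proj (i + j)
      - LinearMap.llcomp K N M M (ρM i) ∘ₗ LinearMap.proj j
      - LinearMap.lcomp K M (ρN j) ∘ₗ LinearMap.proj i
      + LinearMap.llcomp K N M M (ρM j) ∘ₗ LinearMap.proj i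
      + LinearMap.lcomp K M (ρN i) ∘ₗ LinearMap.proj j
  else 0

/-- Constraint on a cocycle expressing that the extension has `p`-character `χ`:
on the extension `E = M ⊕ N` the `(N → M)`-component of `(e_i)^p` is
`∑_{k<p} (ρM i)^k ∘ c i ∘ (ρN i)^(p-1-k)`, and this must agree with the
`(N → M)`-component of `e_i^{[p]} + χ(e_i)^p • 1`, which is `δ_{i0} c i`
(the scalar `χ(e_i)^p` contributes nothing off the diagonal, and the diagonal
blocks hold since `M`, `N` have `p`-character `χ`). -/
def pcharConstraint (p : ℕ) (lo : ℤ) (ρM : ℤ → Module.End K M)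
    (ρN : ℤ → Module.End K N) (i : ℤ) :
    (ℤ → N →ₗ[K] M) →ₗ[K] (N →ₗ[K] M) :=
  if lo ≤ i ∧ i ≤ (p : ℤ) - 2 then
    (∑ k ∈ Finset.range p,
        LinearMap.llcomp K N M M ((ρM i) ^ k) ∘ₗ
          LinearMap.lcomp K M ((ρN i) ^ (p - 1 - k)) ∘ₗ LinearMap.proj i)
      - (if i = 0 then (LinearMap.proj 0 : (ℤ → N →ₗ[K] M) →ₗ[K] (N →ₗ[K] M)) else 0)
  else 0

/-- The space of cocycles: families `c : ℤ → (N →ₗ M)` (the values of a linear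
map `W → Hom(N, M)` on the basis, `lo = -1` for `W` and `lo = 0` for `W_0`)
such that `M ⊕ N` with action `e_k (m, n) = (ρM k m + c k n, ρN k n)` is a
module with `p`-character `χ`. -/
def cocycles (p : ℕ) (lo : ℤ) (ρM : ℤ → Module.End K M) (ρN : ℤ → Module.End K N) :
    Submodule K (ℤ → N →ₗ[K] M) :=
  (⨅ k : ℤ, LinearMap.ker (suppConstraint K M N p lo k)) ⊓
    (⨅ i : ℤ, ⨅ j : ℤ, LinearMap.ker (bracketConstraint K p lo ρM ρN i j)) ⊓
    (⨅ i : ℤ, LinearMap.ker (pcharConstraint K p lo ρM ρN i))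

/-- The coboundaries: cocycles of the form `k ↦ ρM k ∘ f - f ∘ ρN k` for a
linear map `f : N → M`; these are exactly the cocycles of split extensions,
and two cocycles give Baer-equivalent extensions iff they differ by a
coboundary. -/
def coboundaries (p : ℕ) (lo : ℤ) (ρM : ℤ → Module.End K M) (ρN : ℤ → Module.End K N) :
    Submodule K (ℤ → N →ₗ[K] M) :=
  LinearMap.range (LinearMap.pi fun k : ℤ =>
    if lo ≤ k ∧ k ≤ (p : ℤ) - 2 then
      LinearMap.llcomp K N M M (ρM k) - LinearMap.lcomp K M (ρN k)
    else 0)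

/-- The Baer Ext space `Ext(N, M)` in the category of modules with
`p`-character `χ` (over `W` if `lo = -1`, over `W_0` if `lo = 0`), realized
as cocycles modulo coboundaries. -/
abbrev extSpace (p : ℕ) (lo : ℤ) (ρM : ℤ → Module.End K M) (ρN : ℤ → Module.End K N) :=
  (cocycles K p lo ρM ρN) ⧸
    (Submodule.comap (cocycles K p lo ρM ρN).subtype (coboundaries K p lo ρM ρN))

end ExtSpace

end

namespace WittExt

set_option linter.unusedSectionVars false

variable {K : Type} [Field K] {p : ℕ} [hpr : Fact p.Prime] [CharP K p]

/-- The vectors `v_n = e_{-1}^n v_0`, for every natural `n`. -/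
noncomputable def vv (p : ℕ) [hpr : Fact p.Prime] (c : K) (n : ℕ) : Fin p → K :=
  ((vermaRho K p c 0 (-1)) ^ n) (Pi.single ⟨0, hpr.out.pos⟩ 1)

theorem vermaRho_neg_one (c lam : K) : vermaRho K p c lam (-1) = vermaRho K p c 0 (-1) := by
  simp [vermaRho, vermaMat]

theorem vermaRho_of_notMem (c lam : K) {j : ℤ} (hj : j < -1 ∨ (p : ℤ) - 2 < j) :
    vermaRho K p c lam j = 0 := by
  have h1 : j ≠ -1 := by
    have := hpr.out.two_le
    omega
  have h2 : ¬ (0 ≤ j ∧ j ≤ (p : ℤ) - 2) := by omega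
  simp [vermaRho, vermaMat, h1, h2]

theorem vermaRho_neg_one_vv (c lam : K) (n : ℕ) :
    vermaRho K p c lam (-1) (vv p c n) = vv p c (n + 1) := by
  rw [vermaRho_neg_one, vv, vv, pow_succ']
  rfl

theorem vermaRho_pow_vv (c lam : K) (m n : ℕ) :
    (vermaRho K p c lam (-1) ^ m) (vv p c n) = vv p c (n + m) := by
  rw [vermaRho_neg_one, vv, vv, add_comm, pow_add]
  rfl

theorem vermaRho_neg_one_single (c lam : K) {n : ℕ} (hn : n < p) :
    vermaRho K p c lam (-1) (Pi.single ⟨n, hn⟩ 1) =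
      if h : n + 1 < p then Pi.single ⟨n + 1, h⟩ 1 else c • Pi.single ⟨0, hpr.out.pos⟩ 1 := by
  have := hpr.out.two_le
  ext k
  simp only [vermaRho, vermaMat, Matrix.toLin'_apply, Matrix.mulVec_single_one, Matrix.col_apply,
    if_true, Matrix.of_apply]
  split_ifs with h1 h2 h3 h4 h5
  · simp [Pi.single_apply, Fin.ext_iff, h1]
  · omega
  · omega
  · rw [show k = ⟨0, hpr.out.pos⟩ from Fin.ext h3.1]
    simp
  · simp [Fin.ext_iff, h1]
  · have : (k : ℕ) ≠ 0 := by omega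
    simp [Fin.ext_iff, this]

theorem vv_eq_single (c : K) {n : ℕ} (hn : n < p) : vv p c n = Pi.single ⟨n, hn⟩ 1 := by
  induction n with
  | zero => simp [vv]
  | succ n ih =>
    rw [← vermaRho_neg_one_vv c 0, ih (by omega), vermaRho_neg_one_single, dif_pos hn]

theorem vv_p (c : K) : vv p c p = c • vv p c 0 := by
  have := hpr.out.two_le
  obtain ⟨q, hq⟩ : ∃ q, p = q + 1 := ⟨p - 1, by omega⟩
  have h1 : vv p c p = vv p c (q + 1) := by rw [← hq]
  rw [h1, ← vermaRho_neg_one_vv c 0, vv_eq_single c (show q < p by omega),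
    vermaRho_neg_one_single, dif_neg (by omega), vv_eq_single c hpr.out.pos]

theorem vv_add_p (c : K) (n : ℕ) : vv p c (n + p) = c • vv p c n := by
  rw [add_comm, ← vermaRho_pow_vv c 0, vv_p, map_smul, vermaRho_pow_vv, zero_add]

theorem lin_ext (c : K) {M : Type} [AddCommGroup M] [Module K M] {f g : (Fin p → K) →ₗ[K] M}
    (h : ∀ n, f (vv p c n) = g (vv p c n)) : f = g := by
  refine LinearMap.pi_ext' fun i => ?_
  ext
  have := h i
  rw [vv_eq_single c i.2] at this
  simpa using this

theorem vermaRho_neg_one_pow (c lam : K) : vermaRho K p c lam (-1) ^ p = c • 1 :=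
  lin_ext c fun n => by
    rw [vermaRho_pow_vv, vv_add_p]
    rfl

/-- A linear map out of `V_χ(λ)` may be prescribed on all `v_n` subject to periodicity. -/
theorem exists_lin (c : K) {M : Type} [AddCommGroup M] [Module K M] (s : ℕ → M)
    (hs : ∀ n, s (n + p) = c • s n) :
    ∃ f : (Fin p → K) →ₗ[K] M, ∀ n, f (vv p c n) = s n := by
  refine ⟨Fintype.linearCombination K (fun i : Fin p => s i), fun n => ?_⟩
  induction n using Nat.strong_induction_on with
  | _ n ih =>
    rcases lt_or_ge n p with h | h
    · rw [vv_eq_single c h, Fintype.linearCombination_apply_single, one_smul]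
    · obtain ⟨m, rfl⟩ := Nat.exists_eq_add_of_le' h
      rw [vv_add_p, hs, map_smul, ih m (by have := hpr.out.pos; omega)]

theorem wCoef_of_lt (lam : K) {j n : ℕ} (h : n < j) : wCoef K lam j n = 0 := by
  simp [wCoef, Nat.descFactorial_of_lt h]

theorem wCoef_add_p (lam : K) (j n : ℕ) : wCoef K lam j (n + p) = wCoef K lam j n := by
  have h : ((n + p : ℕ) : K) = n := by simp
  simp only [wCoef, ← descPochhammer_eval_eq_descFactorial, h]

theorem vermaRho_vv (c lam : K) {j : ℕ} (hj : j + 2 ≤ p) (n : ℕ) :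
    vermaRho K p c lam j (vv p c n) = wCoef K lam j n • vv p c (n - j) := by
  induction n using Nat.strong_induction_on with
  | _ n ih =>
    rcases lt_or_ge n p with h | h
    · have h1 : ((j : ℤ) = -1) = False := eq_false (by omega)
      have h2 : (0 ≤ (j : ℤ) ∧ (j : ℤ) ≤ (p : ℤ) - 2) = True := eq_true (by omega)
      rw [vv_eq_single c h, vv_eq_single c (show n - j < p by omega)]
      ext k
      simp only [vermaRho, vermaMat, Matrix.toLin'_apply, Matrix.mulVec_single_one,
        Matrix.col_apply, h1, h2, if_true, if_false, Matrix.of_apply, Int.toNat_natCast]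
      split_ifs with h3
      · have : k = ⟨n - j, by omega⟩ := Fin.ext (by simp; omega)
        rw [this]
        simp
      · rcases lt_or_ge n j with h4 | h4
        · simp [wCoef_of_lt lam h4]
        · have : k ≠ ⟨n - j, by omega⟩ := fun h => h3 (by rw [h]; simp; omega)
          simp [this]
    · obtain ⟨m, rfl⟩ := Nat.exists_eq_add_of_le' h
      rw [vv_add_p, map_smul, ih m (by have := hpr.out.pos; omega), wCoef_add_p, smul_comm]
      rcases lt_or_ge m j with h4 | h4
      · simp [wCoef_of_lt lam h4]
      · rw [show m + p - j = (m - j) + p by omega, vv_add_p]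

theorem wCoef_succ_sub (lam : K) (j n : ℕ) :
    wCoef K lam (j + 1) n - wCoef K lam (j + 1) (n + 1) = ((j : K) + 2) * wCoef K lam j n := by
  simp only [wCoef, Nat.succ_descFactorial_succ, Nat.descFactorial_succ]
  rcases lt_or_ge n j with h | h
  · simp [Nat.descFactorial_of_lt h]
  · push_cast [Nat.cast_sub h]
    ring

/-- The bracket relations with `e_{-1}`. -/
theorem vermaRho_bracket_neg_one (c lam : K) (j : ℤ) :
    vermaRho K p c lam (-1) * vermaRho K p c lam j - vermaRho K p c lam j * vermaRho K p c lam (-1)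
      = ((j : K) + 1) • vermaRho K p c lam (j - 1) := by
  have h2p := hpr.out.two_le
  rcases lt_or_ge j (-1) with h | h
  · rw [vermaRho_of_notMem c lam (Or.inl h), vermaRho_of_notMem c lam (j := j - 1) (by omega)]
    simp
  rcases lt_or_ge ((p : ℤ) - 1) j with h' | h'
  · rw [vermaRho_of_notMem c lam (j := j) (by omega),
      vermaRho_of_notMem c lam (j := j - 1) (by omega)]
    simp
  rcases eq_or_lt_of_le h with rfl | h
  · simp
  obtain ⟨m, rfl⟩ := Int.eq_ofNat_of_zero_le (show 0 ≤ j by omega)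
  rcases Nat.eq_zero_or_pos m with rfl | hm
  · refine lin_ext c fun n => ?_
    have h0 := fun n => vermaRho_vv (p := p) c lam (j := 0) (by omega) n
    simp only [Nat.cast_zero, Nat.sub_zero] at h0
    simp only [Nat.cast_zero, Int.cast_zero, zero_add, zero_sub, one_smul,
      LinearMap.sub_apply, Module.End.mul_apply, h0, map_smul, vermaRho_neg_one_vv, ← sub_smul]
    have : wCoef K lam 0 n - wCoef K lam 0 (n + 1) = 1 := by
      simp [wCoef]
    rw [this, one_smul]
  obtain ⟨q, rfl⟩ : ∃ q, m = q + 1 := ⟨m - 1, by omega⟩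
  rcases eq_or_lt_of_le h' with h' | h'
  · rw [vermaRho_of_notMem c lam (j := ((q + 1 : ℕ) : ℤ)) (by omega)]
    have : (((q + 1 : ℕ) : ℤ) : K) + 1 = 0 := by
      have : q + 2 = p := by omega
      rw [← CharP.cast_eq_zero K p, ← this]
      push_cast
      ring
    simp only [this]
    simp
  · refine lin_ext c fun n => ?_
    have e : (((q + 1 : ℕ) : ℤ) - 1) = (q : ℤ) := by push_cast; ring
    rw [e]
    simp only [LinearMap.sub_apply, Module.End.mul_apply, LinearMap.smul_apply,
      vermaRho_vv (p := p) c lam (j := q + 1) (by omega), vermaRho_vv (p := p) c lam (j := q)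
      (by omega), map_smul, vermaRho_neg_one_vv]
    have h3 := wCoef_succ_sub lam q n
    have h4 : (((q + 1 : ℕ) : ℤ) : K) + 1 = (q : K) + 2 := by push_cast; ring
    rw [h4, smul_smul, ← h3, sub_smul, Nat.add_sub_add_right]
    congr 1
    rcases lt_or_ge n (q + 1) with h5 | h5
    · simp [wCoef_of_lt lam h5]
    · rw [show n - (q + 1) + 1 = n - q by omega]

/-- If a family of operators satisfies the bracket relations with `e_{-1}`, and all the other
bracket relations hold on vectors generating the module under `e_{-1}`, then they all hold. -/
theorem bracket_of_generators {X : Type} [AddCommGroup X] [Module K X]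
    (ρ : ℤ → Module.End K X)
    (h : ∀ j : ℤ, ρ (-1) * ρ j - ρ j * ρ (-1) = ((j : K) + 1) • ρ (j - 1)) (G : Set X)
    (hG : ∀ f : Module.End K X, (∀ g ∈ G, ∀ n : ℕ, f ((ρ (-1) ^ n) g) = 0) → f = 0)
    (hg : ∀ g ∈ G, ∀ i j : ℤ, 0 ≤ i → 0 ≤ j →
      ρ i (ρ j g) - ρ j (ρ i g) = ((j : K) - i) • ρ (i + j) g)
    (i j : ℤ) (hi : -1 ≤ i) (hj : -1 ≤ j) :
    ρ i * ρ j - ρ j * ρ i = ((j : K) - i) • ρ (i + j) := by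
  have key : ∀ g ∈ G, ∀ n : ℕ, ∀ i j : ℤ, -1 ≤ i → -1 ≤ j →
      (ρ i * ρ j - ρ j * ρ i - ((j : K) - i) • ρ (i + j)) ((ρ (-1) ^ n) g) = 0 := by
    intro g hgG n
    induction n with
    | zero =>
      intro i j hi hj
      rcases eq_or_lt_of_le hi with rfl | hi
      · rw [h j, show -1 + j = j - 1 by ring]
        simp
      rcases eq_or_lt_of_le hj with rfl | hj
      · have e : ρ i * ρ (-1) - ρ (-1) * ρ i - (((-1 : ℤ) : K) - i) • ρ (i + -1) = 0 := by
          rw [← neg_sub (ρ (-1) * ρ i), h i, show i + -1 = i - 1 by ring]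
          push_cast
          module
        rw [e]
        rfl
      · have := hg g hgG i j (by omega) (by omega)
        simp [this]
    | succ n ih =>
      intro i j hi hj
      have e : ρ (-1) * (ρ i * ρ j - ρ j * ρ i - ((j : K) - i) • ρ (i + j)) -
          (ρ i * ρ j - ρ j * ρ i - ((j : K) - i) • ρ (i + j)) * ρ (-1) =
          ((i : K) + 1) • (ρ (i - 1) * ρ j - ρ j * ρ (i - 1)
              - ((j : K) - (i - 1 : ℤ)) • ρ (i - 1 + j))
          + ((j : K) + 1) • (ρ i * ρ (j - 1) - ρ (j - 1) * ρ i
              - (((j - 1 : ℤ) : K) - i) • ρ (i + (j - 1))) := by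
        have h1 := h i
        have h2 := h j
        have h3 := h (i + j)
        rw [show i - 1 + j = i + j - 1 by ring, show i + (j - 1) = i + j - 1 by ring]
        have h1' : ((i : K) + 1) • (ρ (i - 1) * ρ j - ρ j * ρ (i - 1)) =
            (ρ (-1) * ρ i - ρ i * ρ (-1)) * ρ j - ρ j * (ρ (-1) * ρ i - ρ i * ρ (-1)) := by
          rw [h1, smul_sub, smul_mul_assoc, mul_smul_comm]
        have h2' : ((j : K) + 1) • (ρ i * ρ (j - 1) - ρ (j - 1) * ρ i) =
            ρ i * (ρ (-1) * ρ j - ρ j * ρ (-1)) - (ρ (-1) * ρ j - ρ j * ρ (-1)) * ρ i := by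
          rw [h2, smul_sub, smul_mul_assoc, mul_smul_comm]
        rw [smul_sub, smul_sub _ _ (_ • _), h1', h2']
        have h3' : ρ (-1) * (((j : K) - i) • ρ (i + j)) - (((j : K) - i) • ρ (i + j)) * ρ (-1) =
            (((j : K) - i) * ((i : K) + j + 1)) • ρ (i + j - 1) := by
          rw [mul_smul_comm, smul_mul_assoc, ← smul_sub, h3, smul_smul]
          push_cast
          rfl
        have h4 : (((j : K) - i) * ((i : K) + j + 1)) • ρ (i + j - 1) =
            ((i : K) + 1) • (((j : K) - (i - 1 : ℤ)) • ρ (i + j - 1)) +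
            ((j : K) + 1) • ((((j - 1 : ℤ) : K) - i) • ρ (i + j - 1)) := by
          rw [smul_smul, smul_smul, ← add_smul]
          congr 1
          push_cast
          ring
        rw [mul_sub, sub_mul, sub_sub_sub_comm, h3', h4]
        noncomm_ring
      have e3 : ρ (-1) ((ρ (-1) ^ n) g) = (ρ (-1) ^ (n + 1)) g := by
        rw [pow_succ']
        rfl
      have e' := LinearMap.congr_fun e ((ρ (-1) ^ n) g)
      rw [LinearMap.sub_apply, Module.End.mul_apply, Module.End.mul_apply, ih i j hi hj, map_zero,
        zero_sub, e3, LinearMap.add_apply, LinearMap.smul_apply,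
        LinearMap.smul_apply] at e'
      have e1 : ((i : K) + 1) • (ρ (i - 1) * ρ j - ρ j * ρ (i - 1)
              - ((j : K) - (i - 1 : ℤ)) • ρ (i - 1 + j)) ((ρ (-1) ^ n) g) = 0 := by
        rcases eq_or_lt_of_le hi with rfl | hi
        · simp
        · rw [ih (i - 1) j (by omega) hj, smul_zero]
      have e2 : ((j : K) + 1) • (ρ i * ρ (j - 1) - ρ (j - 1) * ρ i
              - (((j - 1 : ℤ) : K) - i) • ρ (i + (j - 1))) ((ρ (-1) ^ n) g) = 0 := by
        rcases eq_or_lt_of_le hj with rfl | hj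
        · simp
        · rw [ih i (j - 1) hi (by omega), smul_zero]
      rw [e1, e2, add_zero, neg_eq_zero] at e'
      exact e'
  exact sub_eq_zero.1 (hG _ fun g hgG n => key g hgG n i j hi hj)

theorem vermaRho_vv_zero (c lam : K) {j : ℤ} (hj : 0 ≤ j) :
    vermaRho K p c lam j (vv p c 0) = if j = 0 then lam • vv p c 0 else 0 := by
  have h2p := hpr.out.two_le
  rcases lt_or_ge ((p : ℤ) - 2) j with h | h
  · rw [vermaRho_of_notMem c lam (Or.inr h), if_neg (by omega)]
    rfl
  · obtain ⟨m, rfl⟩ := Int.eq_ofNat_of_zero_le hj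
    rw [vermaRho_vv c lam (by omega)]
    split_ifs with h0
    · have : m = 0 := by omega
      subst this
      simp [wCoef]
    · rw [wCoef_of_lt lam (by omega), zero_smul]

theorem vermaRho_bracket (c lam : K) {i j : ℤ} (hi : -1 ≤ i) (hj : -1 ≤ j) :
    vermaRho K p c lam i * vermaRho K p c lam j - vermaRho K p c lam j * vermaRho K p c lam i
      = ((j : K) - i) • vermaRho K p c lam (i + j) := by
  refine bracket_of_generators _ (vermaRho_bracket_neg_one c lam) {vv p c 0} ?_ ?_ i j hi hj
  · intro f hf
    refine lin_ext c fun n => ?_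
    have := hf _ rfl n
    rwa [vermaRho_pow_vv, zero_add] at this
  · rintro g rfl i j hi hj
    rw [vermaRho_vv_zero c lam hi, vermaRho_vv_zero c lam hj, vermaRho_vv_zero c lam (by omega)]
    split_ifs with h1 h2 h3 h4 h5 h6 <;>
      first
      | omega
      | simp_all [vermaRho_vv_zero]

theorem intCast_inj_of_lt {a b : ℤ} (h : (a : K) = b) (h1 : a - b < p) (h2 : b - a < p) :
    a = b := by
  have h3 : ((a - b : ℤ) : K) = 0 := by rw [Int.cast_sub, h, sub_self]
  rw [CharP.intCast_eq_zero_iff K p] at h3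
  have := Int.eq_zero_of_abs_lt_dvd h3 (abs_lt.2 ⟨by omega, by omega⟩)
  omega

theorem intCast_ne_zero_of_lt {a : ℤ} (h : 0 < a) (h1 : a < p) : (a : K) ≠ 0 := fun h0 => by
  have := intCast_inj_of_lt (K := K) (p := p) (a := a) (b := 0) (by simpa using h0) (by omega)
    (by omega)
  omega

theorem factorial_ne_zero {n : ℕ} (hn : n < p) : (n.factorial : K) ≠ 0 := by
  rw [Ne, CharP.cast_eq_zero_iff K p, hpr.out.dvd_factorial]
  omega

/-- The rescaled basis `u_n = v_n / ((-1)^n n!)`, extended by zero to all integers. -/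
noncomputable def uz (p : ℕ) [hpr : Fact p.Prime] (c : K) (n : ℤ) : Fin p → K :=
  if 0 ≤ n ∧ n < p then ((-1) ^ n.toNat * (n.toNat.factorial : K))⁻¹ • vv p c n.toNat else 0

theorem uz_of_neg (c : K) {n : ℤ} (hn : n < 0) : uz p c n = 0 := if_neg (by omega)

theorem uz_apply (c : K) {n : ℕ} (hn : n < p) (i : Fin p) :
    uz p c n i = if (i : ℕ) = n then ((-1) ^ n * (n.factorial : K))⁻¹ else 0 := by
  rw [uz, if_pos ⟨by omega, by omega⟩, Int.toNat_natCast, vv_eq_single c hn]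
  split_ifs with h
  · rw [show i = ⟨n, hn⟩ from Fin.ext h]
    simp
  · have : i ≠ ⟨n, hn⟩ := fun h' => h (by rw [h'])
    simp [this]

theorem uz_ne_zero (c : K) {n : ℤ} (h0 : 0 ≤ n) (hn : n < p) : uz p c n ≠ 0 := by
  obtain ⟨m, rfl⟩ := Int.eq_ofNat_of_zero_le h0
  intro h
  have h1 := congrFun h ⟨m, by omega⟩
  have h2 : (m.factorial : K) ≠ 0 := factorial_ne_zero (p := p) (by omega)
  rw [uz_apply c (by omega), if_pos rfl] at h1
  simp [h2] at h1

theorem exists_eq_smul_uz (c : K) {n : ℤ} (h0 : 0 ≤ n) (hn : n < p) {x : Fin p → K}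
    (hx : ∀ i : Fin p, ((i : ℕ) : ℤ) ≠ n → x i = 0) : ∃ a : K, x = a • uz p c n := by
  obtain ⟨m, rfl⟩ := Int.eq_ofNat_of_zero_le h0
  have h2 : (m.factorial : K) ≠ 0 := factorial_ne_zero (p := p) (by omega)
  refine ⟨x ⟨m, by omega⟩ * ((-1) ^ m * (m.factorial : K)), ?_⟩
  ext i
  rw [Pi.smul_apply, uz_apply c (by omega)]
  split_ifs with h
  · rw [show i = ⟨m, by omega⟩ from Fin.ext h]
    have : ((-1 : K) ^ m) ≠ 0 := by simp
    simp only [smul_eq_mul]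
    field_simp
  · rw [hx i (by exact_mod_cast h), smul_zero]

theorem vermaRho_uz (c lam : K) {j n : ℤ} (hj : 0 ≤ j) (hj' : j ≤ (p : ℤ) - 2) (hn : n < p) :
    vermaRho K p c lam j (uz p c n) = (((j : K) + 1) * lam - n + j) • uz p c (n - j) := by
  rcases lt_or_ge n 0 with h | h
  · rw [uz_of_neg c h, uz_of_neg c (by omega), map_zero, smul_zero]
  obtain ⟨m, rfl⟩ := Int.eq_ofNat_of_zero_le h
  obtain ⟨k, rfl⟩ := Int.eq_ofNat_of_zero_le hj
  rw [uz, if_pos ⟨h, hn⟩, map_smul, Int.toNat_natCast, vermaRho_vv c lam (by omega)]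
  rcases lt_or_ge m k with h1 | h1
  · rw [wCoef_of_lt lam h1, uz_of_neg c (by omega), zero_smul, smul_zero, smul_zero]
  · obtain ⟨q, rfl⟩ := Nat.exists_eq_add_of_le' h1
    rw [show ((q + k : ℕ) : ℤ) - (k : ℤ) = (q : ℤ) by push_cast; ring, uz,
      if_pos ⟨by omega, by omega⟩, Int.toNat_natCast, Nat.add_sub_cancel, smul_smul, smul_smul]
    congr 1
    have h2 := Nat.factorial_mul_descFactorial h1
    rw [Nat.add_sub_cancel] at h2
    have h3 : (q.factorial : K) ≠ 0 := factorial_ne_zero (p := p) (by omega)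
    have h4 : (((q + k).factorial : ℕ) : K) ≠ 0 := factorial_ne_zero (p := p) (by omega)
    rw [← h2] at h4 ⊢
    push_cast at h4 ⊢
    have h5 : ((q + k).descFactorial k : K) ≠ 0 := right_ne_zero_of_mul h4
    have h6 : ((-1 : K) ^ q) ≠ 0 := by simp
    have h7 : ((-1 : K) ^ k) ≠ 0 := by simp
    rw [wCoef, pow_add]
    field_simp
    push_cast
    ring

theorem vermaRho_zero_apply (c lam : K) (x : Fin p → K) (i : Fin p) :
    vermaRho K p c lam 0 x i = (lam - (i : ℕ)) * x i := by
  have h2 : (2 : ℤ) ≤ p := by exact_mod_cast hpr.out.two_le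
  simp only [vermaRho, vermaMat, Matrix.toLin'_apply, Matrix.mulVec, dotProduct]
  rw [Finset.sum_eq_single i]
  · simp [wCoef, h2]
  · intro b _ hb
    have : (b : ℕ) ≠ i := fun h => hb (Fin.ext h)
    simp [this, h2]
  · simp

theorem vermaRho_zero_pow_apply (c lam : K) (n : ℕ) (x : Fin p → K) (i : Fin p) :
    (vermaRho K p c lam 0 ^ n) x i = (lam - (i : ℕ)) ^ n * x i := by
  induction n with
  | zero => simp
  | succ n ih => rw [pow_succ', Module.End.mul_apply, vermaRho_zero_apply, ih, pow_succ']; ring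

/-- The cochain `x ↦ ρ_M(x) f - f ρ_N(x)`. -/
noncomputable def bd (p : ℕ) (c lam lam' : K) (f : Module.End K (Fin p → K)) :
    ℤ → Module.End K (Fin p → K) :=
  fun k => vermaRho K p c lam k * f - f * vermaRho K p c lam' k

theorem bd_add (c lam lam' : K) (f g : Module.End K (Fin p → K)) :
    bd p c lam lam' (f + g) = bd p c lam lam' f + bd p c lam lam' g := by
  funext k
  simp only [bd, Pi.add_apply, mul_add, add_mul]
  abel

theorem mem_coboundaries_iff (c lam lam' : K) (z : ℤ → Module.End K (Fin p → K)) :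
    z ∈ coboundaries K p (-1) (vermaRho K p c lam) (vermaRho K p c lam') ↔
      ∃ f, bd p c lam lam' f = z := by
  have : ∀ f : Module.End K (Fin p → K), (LinearMap.pi fun k : ℤ =>
    if -1 ≤ k ∧ k ≤ (p : ℤ) - 2 then
      LinearMap.llcomp K _ _ _ (vermaRho K p c lam k) - LinearMap.lcomp K _ (vermaRho K p c lam' k)
    else 0) f = bd p c lam lam' f := by
    intro f
    funext k
    rw [LinearMap.pi_apply]
    split_ifs with h
    · rfl
    · rw [bd, vermaRho_of_notMem c lam (by omega), vermaRho_of_notMem c lam' (by omega)]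
      simp
  rw [coboundaries, LinearMap.mem_range]
  simp only [this]

theorem mem_cocycles_iff (c lam lam' : K) (z : ℤ → Module.End K (Fin p → K)) :
    z ∈ cocycles K p (-1) (vermaRho K p c lam) (vermaRho K p c lam') ↔
      (∀ k : ℤ, (k < -1 ∨ (p : ℤ) - 2 < k) → z k = 0) ∧
      (∀ i j : ℤ, -1 ≤ i ∧ i ≤ (p : ℤ) - 2 ∧ -1 ≤ j ∧ j ≤ (p : ℤ) - 2 →
        ((j : K) - i) • z (i + j) = vermaRho K p c lam i * z j + z i * vermaRho K p c lam' j
          - vermaRho K p c lam j * z i - z j * vermaRho K p c lam' i) ∧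
      (∀ i : ℤ, -1 ≤ i ∧ i ≤ (p : ℤ) - 2 →
        ∑ k ∈ Finset.range p, vermaRho K p c lam i ^ k * z i * vermaRho K p c lam' i ^ (p - 1 - k)
          = if i = 0 then z 0 else 0) := by
  simp only [cocycles, Submodule.mem_inf, Submodule.mem_iInf, LinearMap.mem_ker, and_assoc]
  refine and_congr (forall_congr' fun k => ?_) (and_congr (forall_congr' fun i =>
    forall_congr' fun j => ?_) (forall_congr' fun i => ?_))
  · rw [suppConstraint]
    split_ifs with h <;> simp [h]
  · rw [bracketConstraint]
    split_ifs with h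
    · simp only [h, and_self, true_imp_iff]
      simp only [LinearMap.add_apply, LinearMap.sub_apply, LinearMap.smul_apply,
        LinearMap.comp_apply, LinearMap.proj_apply, Int.cast_sub]
      have e1 : ∀ f g : Module.End K (Fin p → K), LinearMap.llcomp K _ _ _ f g = f * g :=
        fun _ _ => rfl
      have e2 : ∀ f g : Module.End K (Fin p → K), LinearMap.lcomp K (Fin p → K) f g = g * f :=
        fun _ _ => rfl
      simp only [e1, e2]
      rw [← sub_eq_zero (b := _ - _)]
      refine Eq.congr ?_ rfl
      abel
    · simp [h]
  · rw [pcharConstraint]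
    by_cases h : -1 ≤ i ∧ i ≤ (p : ℤ) - 2
    · rw [if_pos h]
      refine Iff.trans ?_ ⟨fun h' _ => h', fun h' => h' h⟩
      split_ifs with h'
      · rw [LinearMap.sub_apply, sub_eq_zero, LinearMap.sum_apply]
        rfl
      · rw [LinearMap.sub_apply, sub_eq_zero, LinearMap.sum_apply]
        rfl
    · rw [if_neg h]
      exact ⟨fun _ h' => absurd h' h, fun _ => rfl⟩

/-- Cochains with the right support that satisfy the bracket relations of a cocycle. -/
structure IsBr (c lam lam' : K) (z : ℤ → Module.End K (Fin p → K)) : Prop where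
  supp : ∀ k : ℤ, (k < -1 ∨ (p : ℤ) - 2 < k) → z k = 0
  br : ∀ i j : ℤ, -1 ≤ i → -1 ≤ j →
    ((j : K) - i) • z (i + j) = vermaRho K p c lam i * z j + z i * vermaRho K p c lam' j
      - vermaRho K p c lam j * z i - z j * vermaRho K p c lam' i

theorem cast_p_sub_one : (((p : ℤ) - 1 : ℤ) : K) = -1 := by simp

theorem IsBr.of_mem_cocycles {c lam lam' : K} {z : ℤ → Module.End K (Fin p → K)}
    (hz : z ∈ cocycles K p (-1) (vermaRho K p c lam) (vermaRho K p c lam')) :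
    IsBr c lam lam' z := by
  have h2 := hpr.out.two_le
  obtain ⟨hs, hb, -⟩ := (mem_cocycles_iff c lam lam' z).1 hz
  refine ⟨hs, fun i j hi hj => ?_⟩
  by_cases h : i ≤ (p : ℤ) - 2 ∧ j ≤ (p : ℤ) - 2
  · exact hb i j ⟨hi, h.1, hj, h.2⟩
  have hc : ((j : K) - i) • z (i + j) = 0 := by
    by_cases h3 : i = (p : ℤ) - 1 ∧ j = -1
    · rw [h3.1, h3.2, cast_p_sub_one]
      simp
    by_cases h4 : j = (p : ℤ) - 1 ∧ i = -1
    · rw [h4.1, h4.2, cast_p_sub_one]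
      simp
    rw [hs _ (by omega), smul_zero]
  rw [hc]
  by_cases h5 : i ≤ (p : ℤ) - 2
  · have h6 : (p : ℤ) - 2 < j := by omega
    simp [hs j (Or.inr h6), vermaRho_of_notMem c lam (Or.inr h6),
      vermaRho_of_notMem c lam' (Or.inr h6)]
  · have h6 : (p : ℤ) - 2 < i := by omega
    simp [hs i (Or.inr h6), vermaRho_of_notMem c lam (Or.inr h6),
      vermaRho_of_notMem c lam' (Or.inr h6)]

theorem IsBr.sub {c lam lam' : K} {z w : ℤ → Module.End K (Fin p → K)}
    (hz : IsBr c lam lam' z) (hw : IsBr c lam lam' w) : IsBr c lam lam' (z - w) := by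
  refine ⟨fun k hk => by simp [hz.supp k hk, hw.supp k hk], fun i j hi hj => ?_⟩
  simp only [Pi.sub_apply]
  rw [smul_sub, hz.br i j hi hj, hw.br i j hi hj]
  simp only [mul_sub, sub_mul]
  abel

theorem IsBr.smul {c lam lam' : K} {z : ℤ → Module.End K (Fin p → K)}
    (hz : IsBr c lam lam' z) (t : K) : IsBr c lam lam' (t • z) := by
  refine ⟨fun k hk => by simp [hz.supp k hk], fun i j hi hj => ?_⟩
  simp only [Pi.smul_apply]
  rw [smul_comm, hz.br i j hi hj]
  simp only [mul_smul_comm, smul_mul_assoc, smul_sub, smul_add]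

theorem isBr_bd (c lam lam' : K) (f : Module.End K (Fin p → K)) :
    IsBr c lam lam' (bd p c lam lam' f) := by
  refine ⟨fun k hk => by
    simp [bd, vermaRho_of_notMem c lam hk, vermaRho_of_notMem c lam' hk], fun i j hi hj => ?_⟩
  simp only [bd]
  rw [smul_sub, ← smul_mul_assoc, ← mul_smul_comm, ← vermaRho_bracket c lam hi hj,
    ← vermaRho_bracket c lam' hi hj]
  simp only [mul_sub, sub_mul, mul_assoc]
  abel

/-- Bracket-compatible cochains vanishing at `e_{-1}` and killing `v_0` at `e_0`. -/
structure IsNorm (c lam lam' : K) (z : ℤ → Module.End K (Fin p → K)) : Prop where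
  isBr : IsBr c lam lam' z
  neg_one : z (-1) = 0
  zero : z 0 (vv p c 0) = 0

theorem IsNorm.sub {c lam lam' : K} {z w : ℤ → Module.End K (Fin p → K)}
    (hz : IsNorm c lam lam' z) (hw : IsNorm c lam lam' w) : IsNorm c lam lam' (z - w) :=
  ⟨hz.isBr.sub hw.isBr, by simp [hz.neg_one, hw.neg_one], by simp [hz.zero, hw.zero]⟩

theorem IsNorm.smul {c lam lam' : K} {z : ℤ → Module.End K (Fin p → K)}
    (hz : IsNorm c lam lam' z) (t : K) : IsNorm c lam lam' (t • z) :=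
  ⟨hz.isBr.smul t, by simp [hz.neg_one], by simp [hz.zero]⟩

/-- The operator commuting with `e_{-1}` and sending `v_0` to `y`. -/
theorem exists_commuting (c lam lam' : K) (y : Fin p → K) : ∃ f : Module.End K (Fin p → K),
    f (vv p c 0) = y ∧ bd p c lam lam' f (-1) = 0 := by
  obtain ⟨f, hf⟩ := exists_lin c (fun n => (vermaRho K p c lam (-1) ^ n) y) (fun n => by
    rw [pow_add, vermaRho_neg_one_pow, mul_smul_comm, mul_one, LinearMap.smul_apply])
  refine ⟨f, by simp [hf], lin_ext c fun n => ?_⟩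
  simp only [bd, LinearMap.sub_apply, Module.End.mul_apply, vermaRho_neg_one_vv, hf, pow_succ',
    sub_self, LinearMap.zero_apply]

theorem IsNorm.br_vv_zero {c lam lam' : K} {z : ℤ → Module.End K (Fin p → K)}
    (hz : IsNorm c lam lam' z) {i j : ℤ} (hi : 1 ≤ i) (hj : 1 ≤ j) :
    ((j : K) - i) • z (i + j) (vv p c 0) =
      vermaRho K p c lam i (z j (vv p c 0)) - vermaRho K p c lam j (z i (vv p c 0)) := by
  have h := LinearMap.congr_fun (hz.isBr.br i j (by omega) (by omega)) (vv p c 0)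
  simp only [LinearMap.sub_apply, LinearMap.add_apply, LinearMap.smul_apply,
    Module.End.mul_apply] at h
  rw [vermaRho_vv_zero c lam' (by omega), vermaRho_vv_zero c lam' (by omega), if_neg (by omega),
    if_neg (by omega)] at h
  simpa using h

theorem IsNorm.exists_eq_smul {c lam lam' : K} {z : ℤ → Module.End K (Fin p → K)}
    (hz : IsNorm c lam lam' z) {j m : ℤ} (hj : 1 ≤ j) (h0 : 0 ≤ m) (hm : m < p)
    (h : (m : K) = lam - lam' - j) : ∃ a : K, z j (vv p c 0) = a • uz p c m := by
  refine exists_eq_smul_uz c h0 hm fun i hi => ?_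
  have h1 := LinearMap.congr_fun (hz.isBr.br 0 j (by omega) (by omega)) (vv p c 0)
  simp only [LinearMap.sub_apply, LinearMap.add_apply, LinearMap.smul_apply,
    Module.End.mul_apply] at h1
  rw [vermaRho_vv_zero c lam' (by omega), vermaRho_vv_zero c lam' (by omega), if_neg (by omega),
    if_pos rfl, hz.zero] at h1
  have h2 := congrFun h1 i
  simp only [map_zero, map_smul, Pi.sub_apply, Pi.smul_apply, vermaRho_zero_apply,
    smul_eq_mul, zero_add, Int.cast_zero, add_zero, sub_zero] at h2
  have h3 : ((m : K) - ((i : ℕ) : ℤ)) * z j (vv p c 0) i = 0 := by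
    rw [h]
    push_cast
    linear_combination -h2
  rcases mul_eq_zero.1 h3 with h4 | h4
  · exact absurd (intCast_inj_of_lt (p := p) (sub_eq_zero.1 h4) (by omega) (by omega)).symm hi
  · exact h4

theorem IsNorm.eq_zero {c lam lam' : K} {z : ℤ → Module.End K (Fin p → K)}
    (hz : IsNorm c lam lam' z) (h1 : z 1 (vv p c 0) = 0) (h2 : z 2 (vv p c 0) = 0) : z = 0 := by
  have key : ∀ n : ℕ, z ((n : ℤ) + 2) (vv p c 0) = 0 := by
    intro n
    induction n with
    | zero => simpa using h2
    | succ n ih =>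
      rcases lt_or_ge ((p : ℤ) - 2) ((n : ℤ) + 3) with h | h
      · rw [hz.isBr.supp _ (Or.inr (by push_cast; omega))]
        rfl
      · have h3 := hz.br_vv_zero (i := 1) (j := (n : ℤ) + 2) le_rfl (by omega)
        rw [ih, h1, map_zero, map_zero, sub_zero] at h3
        have h4 : (((n : ℤ) + 2 : ℤ) : K) - ((1 : ℤ) : K) ≠ 0 := by
          rw [← Int.cast_sub]
          exact intCast_ne_zero_of_lt (p := p) (by omega) (by omega)
        have h5 := (smul_eq_zero.1 h3).resolve_left h4
        rw [← h5]
        congr 2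
        push_cast
        ring
  have key2 : ∀ n : ℕ, ∀ j : ℤ, z j (vv p c n) = 0 := by
    intro n
    induction n with
    | zero =>
      intro j
      rcases lt_or_ge j (-1) with h | h
      · rw [hz.isBr.supp _ (Or.inl h)]
        rfl
      rcases eq_or_lt_of_le h with rfl | h
      · rw [hz.neg_one]
        rfl
      by_cases h3 : j = 0
      · rw [h3, hz.zero]
      by_cases h4 : j = 1
      · rw [h4, h1]
      have := key (j - 2).toNat
      rwa [show ((j - 2).toNat : ℤ) + 2 = j by omega] at this
    | succ n ih =>
      intro j
      rcases lt_or_ge j (-1) with h | h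
      · rw [hz.isBr.supp _ (Or.inl h)]
        rfl
      have h3 := LinearMap.congr_fun (hz.isBr.br (-1) j le_rfl h) (vv p c n)
      simp only [LinearMap.sub_apply, LinearMap.add_apply, LinearMap.smul_apply,
        Module.End.mul_apply, hz.neg_one, vermaRho_neg_one_vv, ih] at h3
      simpa using h3
  funext j
  exact lin_ext c fun n => by rw [key2]; rfl

theorem exists_isNorm {c lam lam' : K} {d : ℤ} (h0 : 0 ≤ d) (hd : d < p)
    (h : (d : K) = lam - lam') {z : ℤ → Module.End K (Fin p → K)}
    (hz : z ∈ cocycles K p (-1) (vermaRho K p c lam) (vermaRho K p c lam')) :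
    ∃ f, IsNorm c lam lam' (z - bd p c lam lam' f) := by
  have h2p := hpr.out.two_le
  have hbr := IsBr.of_mem_cocycles hz
  obtain ⟨hs, hb, hp⟩ := (mem_cocycles_iff c lam lam' z).1 hz
  let s : ℕ → (Fin p → K) := fun n =>
    -∑ k ∈ Finset.range n, (vermaRho K p c lam (-1) ^ k) (z (-1) (vv p c (n - 1 - k)))
  have hs1 : ∀ n, s (n + 1) = vermaRho K p c lam (-1) (s n) - z (-1) (vv p c n) := by
    intro n
    simp only [s, Finset.sum_range_succ', map_neg, map_sum]
    rw [neg_add, sub_eq_add_neg]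
    congr 2
    refine Finset.sum_congr rfl fun k _ => ?_
    rw [pow_succ', Module.End.mul_apply, show n + 1 - 1 - (k + 1) = n - 1 - k by omega]
  have hsp : s p = 0 := by
    have h3 := LinearMap.congr_fun (hp (-1) ⟨le_rfl, by omega⟩) (vv p c 0)
    simp only [LinearMap.sum_apply, Module.End.mul_apply, vermaRho_pow_vv, zero_add] at h3
    simp only [s]
    rw [h3]
    simp
  have hs2 : ∀ n, s (n + p) = c • s n := by
    intro n
    induction n with
    | zero => simp [hsp, s]
    | succ n ih =>
      rw [show n + 1 + p = n + p + 1 by ring, hs1, hs1, ih, vv_add_p, map_smul, map_smul, smul_sub]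
  obtain ⟨f, hf⟩ := exists_lin c s hs2
  have hf1 : bd p c lam lam' f (-1) = z (-1) := lin_ext c fun n => by
    simp only [bd, LinearMap.sub_apply, Module.End.mul_apply, vermaRho_neg_one_vv, hf, hs1]
    abel
  obtain ⟨e, rfl⟩ := Int.eq_ofNat_of_zero_le h0
  let x : Fin p → K := (z 0 - bd p c lam lam' f 0) (vv p c 0)
  have hB : ∀ n, (vermaRho K p c lam' 0 ^ n) (vv p c 0) = lam' ^ n • vv p c 0 := by
    intro n
    induction n with
    | zero => simp
    | succ n ih =>
      rw [pow_succ', Module.End.mul_apply, ih, map_smul, vermaRho_vv_zero c lam' le_rfl,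
        if_pos rfl, smul_smul, pow_succ]
  have he : lam - (e : K) = lam' := by
    have : (e : K) = lam - lam' := by exact_mod_cast h
    rw [this]
    ring
  have hxe : x ⟨e, by omega⟩ = 0 := by
    have h3 := congrFun (LinearMap.congr_fun (hp 0 ⟨by omega, by omega⟩) (vv p c 0)) ⟨e, by omega⟩
    simp only [LinearMap.sum_apply, Module.End.mul_apply, hB, map_smul, if_true,
      Finset.sum_apply, Pi.smul_apply, vermaRho_zero_pow_apply, smul_eq_mul, he] at h3
    have h4 : ∀ k ∈ Finset.range p, lam' ^ (p - 1 - k) * (lam' ^ k * z 0 (vv p c 0) ⟨e, by omega⟩)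
        = lam' ^ (p - 1) * z 0 (vv p c 0) ⟨e, by omega⟩ := by
      intro k hk
      rw [← mul_assoc, ← pow_add, Nat.sub_add_cancel]
      have := Finset.mem_range.1 hk
      omega
    rw [Finset.sum_congr rfl h4, Finset.sum_const, Finset.card_range, nsmul_eq_mul,
      CharP.cast_eq_zero, zero_mul] at h3
    simp only [x, bd, LinearMap.sub_apply, Module.End.mul_apply, Pi.sub_apply,
      vermaRho_zero_apply, vermaRho_vv_zero c lam' le_rfl, if_true, map_smul, Pi.smul_apply,
      smul_eq_mul, he, ← h3]
    ring
  obtain ⟨g, hg0, hg1⟩ := exists_commuting c lam lam' (fun i => x i / (lam - (i : ℕ) - lam'))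
  refine ⟨f + g, ⟨hbr.sub (isBr_bd _ _ _ _), ?_, ?_⟩⟩
  · rw [bd_add, Pi.sub_apply, Pi.add_apply, hf1, hg1, add_zero, sub_self]
  · have : (z - bd p c lam lam' (f + g)) 0 (vv p c 0) = x - bd p c lam lam' g 0 (vv p c 0) := by
      rw [bd_add]
      simp only [x, Pi.sub_apply, Pi.add_apply, LinearMap.sub_apply, LinearMap.add_apply]
      abel
    rw [this]
    ext i
    simp only [bd, LinearMap.sub_apply, Module.End.mul_apply, Pi.sub_apply,
      vermaRho_vv_zero c lam' le_rfl, if_true, map_smul, hg0, Pi.smul_apply, smul_eq_mul,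
      vermaRho_zero_apply, Pi.zero_apply]
    by_cases hi : (i : ℕ) = e
    · rw [show i = ⟨e, by omega⟩ from Fin.ext hi, hxe]
      simp
    · have h5 : lam - (i : ℕ) - lam' ≠ 0 := fun h6 => hi (by
        have h7 : ((e : ℤ) : K) = ((i : ℕ) : ℤ) := by
          push_cast
          rw [← he] at h6
          linear_combination h6
        have := intCast_inj_of_lt (p := p) h7 (by omega) (by omega)
        omega)
      field_simp
      ring

theorem charP_end (V : Type) [AddCommGroup V] [Module K V] [Nontrivial V] :
    CharP (Module.End K V) p :=
  charP_of_injective_algebraMap (R := K) (FaithfulSMul.algebraMap_injective _ _) p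

/-- `ad(P)^p = ad(P^p)` in characteristic `p`, so `P^p` commutes with `Q` if `ad(P)^p Q = 0`. -/
theorem commute_pow_char {X : Type} [AddCommGroup X] [Module K X] [Nontrivial X]
    {P Q : Module.End K X}
    (h : ((LinearMap.mulLeft K P - LinearMap.mulRight K P) ^ p) Q = 0) :
    P ^ p * Q = Q * P ^ p := by
  have : CharP (Module.End K (Module.End K X)) p :=
    charP_of_injective_algebraMap (R := K) (FaithfulSMul.algebraMap_injective _ _) p
  rw [sub_pow_char_of_commute p (LinearMap.commute_mulLeft_right P P), LinearMap.pow_mulLeft,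
    LinearMap.pow_mulRight] at h
  simpa [sub_eq_zero] using h

theorem commute_pow_char_of_bracket {X : Type} [AddCommGroup X] [Module K X] [Nontrivial X]
    {ρ : ℤ → Module.End K X} (hs : ∀ k : ℤ, (p : ℤ) - 2 < k → ρ k = 0)
    (hb : ∀ i j : ℤ, -1 ≤ i → -1 ≤ j → ρ i * ρ j - ρ j * ρ i = ((j : K) - i) • ρ (i + j))
    {i : ℤ} (hi : 1 ≤ i) : ρ i ^ p * ρ (-1) = ρ (-1) * ρ i ^ p := by
  refine commute_pow_char ?_
  have key : ∀ n : ℕ, ∃ t : K,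
      ((LinearMap.mulLeft K (ρ i) - LinearMap.mulRight K (ρ i)) ^ n) (ρ (-1))
        = t • ρ (n * i - 1) := by
    intro n
    induction n with
    | zero => exact ⟨1, by simp⟩
    | succ n ih =>
      obtain ⟨t, ht⟩ := ih
      have h0 : 0 ≤ (n : ℤ) * i := by positivity
      refine ⟨t * (((n * i - 1 : ℤ) : K) - i), ?_⟩
      rw [pow_succ', Module.End.mul_apply, ht, LinearMap.sub_apply, LinearMap.mulLeft_apply,
        LinearMap.mulRight_apply, mul_smul_comm, smul_mul_assoc, ← smul_sub,
        hb i _ (by omega) (by omega), smul_smul]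
      congr 2
      push_cast
      ring
  obtain ⟨t, ht⟩ := key p
  rw [ht, hs, smul_zero]
  nlinarith [hpr.out.pos]

section Block

variable {V : Type} [AddCommGroup V] [Module K V]

/-- The block upper triangular operator with diagonal blocks `a`, `b` and corner `x`. -/
def blk (a x b : Module.End K V) : Module.End K (V × V) :=
  LinearMap.prod (a ∘ₗ LinearMap.fst K V V + x ∘ₗ LinearMap.snd K V V) (b ∘ₗ LinearMap.snd K V V)

theorem blk_apply (a x b : Module.End K V) (m n : V) : blk a x b (m, n) = (a m + x n, b n) := rfl

theorem blk_mul (a x b a' x' b' : Module.End K V) :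
    blk a x b * blk a' x' b' = blk (a * a') (a * x' + x * b') (b * b') := by
  refine LinearMap.ext fun ⟨m, n⟩ => ?_
  simp only [Module.End.mul_apply, blk_apply, LinearMap.add_apply, map_add, add_assoc]

theorem blk_sub (a x b a' x' b' : Module.End K V) :
    blk a x b - blk a' x' b' = blk (a - a') (x - x') (b - b') := by
  refine LinearMap.ext fun ⟨m, n⟩ => ?_
  simp only [blk_apply, LinearMap.sub_apply, Prod.mk_sub_mk]
  congr 1
  abel

theorem blk_smul (t : K) (a x b : Module.End K V) :
    t • blk a x b = blk (t • a) (t • x) (t • b) := by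
  refine LinearMap.ext fun ⟨m, n⟩ => ?_
  simp only [blk_apply, LinearMap.smul_apply, Prod.smul_mk, smul_add]

theorem blk_zero : blk (0 : Module.End K V) 0 0 = 0 := by
  refine LinearMap.ext fun ⟨m, n⟩ => ?_
  simp [blk_apply]

theorem blk_corner_inj {a x b a' x' b' : Module.End K V} (h : blk a x b = blk a' x' b') :
    x = x' := by
  refine LinearMap.ext fun n => ?_
  have := congrArg Prod.fst (LinearMap.congr_fun h (0, n))
  simpa [blk_apply] using this

theorem blk_pow (a x b : Module.End K V) (n : ℕ) :
    blk a x b ^ n = blk (a ^ n) (∑ k ∈ Finset.range n, a ^ k * x * b ^ (n - 1 - k)) (b ^ n) := by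
  induction n with
  | zero =>
    refine LinearMap.ext fun ⟨m, n⟩ => ?_
    simp [blk_apply]
  | succ n ih =>
    rw [pow_succ', ih, blk_mul, ← pow_succ', ← pow_succ', Finset.sum_range_succ', Finset.mul_sum]
    congr 2
    refine Finset.sum_congr rfl fun k _ => ?_
    rw [pow_succ', show n + 1 - 1 - (k + 1) = n - 1 - k by omega]
    simp only [mul_assoc]

end Block

theorem shift_pow_char (c lam : K) (s : ℕ → ℤ → (Fin p → K))
    (hs : ∀ n j, s (n + 1) j = vermaRho K p c lam (-1) (s n j) - ((j : K) + 1) • s n (j - 1))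
    (n : ℕ) : s (n + p) = c • s n := by
  have hp0 := hpr.out.pos
  let E : Module.End K (ℤ → (Fin p → K)) :=
    LinearMap.pi fun j => vermaRho K p c lam (-1) ∘ₗ LinearMap.proj j
  let S : Module.End K (ℤ → (Fin p → K)) :=
    LinearMap.pi fun j => ((j : K) + 1) • LinearMap.proj (j - 1)
  have hT : ∀ m, ((E - S) ^ m) (s n) = s (n + m) := by
    intro m
    induction m with
    | zero => simp
    | succ m ih =>
      rw [pow_succ', Module.End.mul_apply, ih]
      funext j
      rw [← add_assoc, hs]
      rfl
  have hcomm : Commute E S := by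
    refine LinearMap.ext fun C => funext fun j => ?_
    simp only [E, S, Module.End.mul_apply, LinearMap.pi_apply, LinearMap.comp_apply,
      LinearMap.smul_apply, LinearMap.proj_apply, map_smul]
  have hE : ∀ m C j, (E ^ m) C j = (vermaRho K p c lam (-1) ^ m) (C j) := by
    intro m C j
    induction m with
    | zero => simp
    | succ m ih =>
      rw [pow_succ', pow_succ', Module.End.mul_apply, Module.End.mul_apply, ← ih]
      rfl
  have hS : ∀ (m : ℕ) C j, (S ^ m) C j =
      (∏ k ∈ Finset.range m, ((j : K) + 1 - k)) • C (j - m) := by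
    intro m
    induction m with
    | zero => simp
    | succ m ih =>
      intro C j
      rw [pow_succ, Module.End.mul_apply, ih, Finset.prod_range_succ, mul_smul]
      simp only [S, LinearMap.pi_apply, LinearMap.smul_apply, LinearMap.proj_apply]
      congr 2
      · push_cast
        ring
      · push_cast
        congr 1
        ring
  have hSp : S ^ p = 0 := by
    refine LinearMap.ext fun C => funext fun j => ?_
    rw [hS]
    have hm : 0 ≤ (j + 1) % (p : ℤ) := Int.emod_nonneg _ (by omega)
    have hm' : (j + 1) % (p : ℤ) < p := Int.emod_lt_of_pos _ (by omega)
    rw [Finset.prod_eq_zero (i := ((j + 1) % (p : ℤ)).toNat) (by simp; omega), zero_smul]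
    · rfl
    · have : (((j + 1) % (p : ℤ) : ℤ) : K) = ((j + 1 : ℤ) : K) := by
        rw [CharP.intCast_eq_intCast K p]
        exact Int.mod_modEq _ _
      have h3 : ((((j + 1) % (p : ℤ)).toNat : ℕ) : K) = (((j + 1) % (p : ℤ) : ℤ) : K) := by
        conv_rhs => rw [← Int.toNat_of_nonneg hm]
        push_cast
        rfl
      rw [h3, this]
      push_cast
      ring
  have : CharP (Module.End K (ℤ → (Fin p → K))) p := by
    have : Nonempty (Fin p) := ⟨⟨0, hp0⟩⟩
    exact charP_end _
  rw [← hT p, sub_pow_char_of_commute p hcomm, hSp, sub_zero]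
  funext j
  rw [hE, vermaRho_neg_one_pow]
  rfl

/-- A cocycle vanishing at `e_{-1}` is determined by its values on `v_0`; the compatible values
are described here. -/
theorem exists_cocycle (c lam lam' : K) (x : ℤ → (Fin p → K)) (hx0 : ∀ j ≤ 0, x j = 0)
    (hx1 : ∀ j, (p : ℤ) - 2 < j → x j = 0)
    (hR : ∀ i j : ℤ, 1 ≤ i → 1 ≤ j → ((j : K) - i) • x (i + j) =
      vermaRho K p c lam i (x j) - vermaRho K p c lam j (x i))
    (hW : ∀ j, 1 ≤ j → vermaRho K p c lam 0 (x j) = (lam' + j) • x j)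
    (hP : ∀ i, 1 ≤ i → (vermaRho K p c lam i ^ (p - 1)) (x i) = 0) :
    ∃ z ∈ cocycles K p (-1) (vermaRho K p c lam) (vermaRho K p c lam'),
      IsNorm c lam lam' z ∧ ∀ j, z j (vv p c 0) = x j := by
  have hp2 := hpr.out.two_le
  let s : ℕ → ℤ → (Fin p → K) := fun n => Nat.rec x (fun _ y j =>
    vermaRho K p c lam (-1) (y j) - ((j : K) + 1) • y (j - 1)) n
  have hs0 : s 0 = x := rfl
  have hs : ∀ n j, s (n + 1) j
      = vermaRho K p c lam (-1) (s n j) - ((j : K) + 1) • s n (j - 1) := fun _ _ => rfl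
  choose z hz using fun j => exists_lin c (fun n => s n j) fun n =>
    congrFun (shift_pow_char c lam s hs n) j
  have hneg : ∀ n, ∀ j ≤ 0, s n j = 0 := by
    intro n
    induction n with
    | zero => exact hx0
    | succ n ih => intro j hj; rw [hs, ih j hj, ih (j - 1) (by omega)]; simp
  have hbig : ∀ n j, (p : ℤ) - 2 < j → s n j = 0 := by
    intro n
    induction n with
    | zero => exact hx1
    | succ n ih =>
      intro j hj
      rw [hs, ih j hj]
      by_cases h : j = (p : ℤ) - 1
      · rw [h, cast_p_sub_one]
        simp
      · rw [ih (j - 1) (by omega)]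
        simp
  have hzneg : ∀ j ≤ 0, z j = 0 := fun j hj => lin_ext c fun n => by
    rw [hz, hneg n j hj]
    rfl
  have hzbig : ∀ j, (p : ℤ) - 2 < j → z j = 0 := fun j hj => lin_ext c fun n => by
    rw [hz, hbig n j hj]
    rfl
  have hz0 : ∀ j, z j (vv p c 0) = x j := fun j => by rw [hz, hs0]
  have hE : ∀ j, vermaRho K p c lam (-1) * z j - z j * vermaRho K p c lam' (-1)
      = ((j : K) + 1) • z (j - 1) := fun j => lin_ext c fun n => by
    simp only [LinearMap.sub_apply, Module.End.mul_apply, vermaRho_neg_one_vv, hz, hs,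
      LinearMap.smul_apply]
    abel
  let ρ : ℤ → Module.End K ((Fin p → K) × (Fin p → K)) := fun k =>
    blk (vermaRho K p c lam k) (z k) (vermaRho K p c lam' k)
  have hρ1 : ∀ j : ℤ, ρ (-1) * ρ j - ρ j * ρ (-1) = ((j : K) + 1) • ρ (j - 1) := by
    intro j
    simp only [ρ, blk_mul, blk_sub, blk_smul, hzneg (-1) (by omega)]
    rw [vermaRho_bracket_neg_one, vermaRho_bracket_neg_one, ← hE]
    simp
  have hpow1 : ∀ n, (ρ (-1) ^ n) (vv p c 0, 0) = (vv p c n, 0) := by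
    intro n
    rw [blk_pow, blk_apply, vermaRho_pow_vv]
    simp
  have hpow2 : ∀ n, (ρ (-1) ^ n) (0, vv p c 0) = (0, vv p c n) := by
    intro n
    rw [blk_pow, blk_apply, vermaRho_pow_vv, hzneg (-1) (by omega)]
    simp
  have hbr := bracket_of_generators ρ hρ1 {(vv p c 0, 0), (0, vv p c 0)} (by
    intro f hf
    refine LinearMap.prod_ext (lin_ext c fun n => ?_) (lin_ext c fun n => ?_)
    · have := hf (vv p c 0, 0) (by simp) n
      rw [hpow1] at this
      simpa using this
    · have := hf (0, vv p c 0) (by simp) n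
      rw [hpow2] at this
      simpa using this) (by
    have hA : ∀ i j : ℤ, 0 ≤ i → 0 ≤ j → ∀ mu : K,
        vermaRho K p c mu i (vermaRho K p c mu j (vv p c 0))
          - vermaRho K p c mu j (vermaRho K p c mu i (vv p c 0))
          = ((j : K) - i) • vermaRho K p c mu (i + j) (vv p c 0) := fun i j hi hj mu =>
      LinearMap.congr_fun (vermaRho_bracket c mu (i := i) (j := j) (by omega) (by omega))
        (vv p c 0)
    intro g hg i j hi hj
    rcases hg with rfl | rfl
    · simp only [ρ, blk_apply, map_zero, add_zero, Prod.mk_sub_mk, sub_zero, Prod.smul_mk,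
        smul_zero, hA i j hi hj]
    · simp only [ρ, blk_apply, map_zero, zero_add, Prod.mk_sub_mk, Prod.smul_mk,
        hA i j hi hj, hz0]
      congr 1
      rw [vermaRho_vv_zero c lam' hi, vermaRho_vv_zero c lam' hj]
      rcases eq_or_lt_of_le hi with rfl | hi <;> rcases eq_or_lt_of_le hj with rfl | hj
      · simp [hx0]
      · rw [if_pos rfl, if_neg (by omega), map_zero, map_smul, hz0, hW j (by omega),
          hx0 0 le_rfl]
        simp [add_smul]
      · rw [if_pos rfl, if_neg (by omega), map_zero, map_smul, hz0, hW i (by omega),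
          hx0 0 le_rfl]
        simp [add_smul]
      · rw [if_neg (by omega), if_neg (by omega), map_zero, map_zero, add_zero, add_zero,
          hR i j (by omega) (by omega)])
  have hρbig : ∀ k : ℤ, (p : ℤ) - 2 < k → ρ k = 0 := fun k hk => by
    simp only [ρ, hzbig k hk, vermaRho_of_notMem c lam (Or.inr hk),
      vermaRho_of_notMem c lam' (Or.inr hk), blk_zero]
  have hbr' : ∀ i j : ℤ, -1 ≤ i → -1 ≤ j → ((j : K) - i) • z (i + j)
      = vermaRho K p c lam i * z j + z i * vermaRho K p c lam' j
        - vermaRho K p c lam j * z i - z j * vermaRho K p c lam' i := by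
    intro i j hi hj
    have := hbr i j hi hj
    simp only [ρ, blk_mul, blk_sub, blk_smul] at this
    rw [← blk_corner_inj this]
    abel
  have hsupp : ∀ k : ℤ, (k < -1 ∨ (p : ℤ) - 2 < k) → z k = 0 := fun k hk =>
    hk.elim (fun h => hzneg k (by omega)) (hzbig k)
  refine ⟨z, (mem_cocycles_iff c lam lam' z).2 ⟨hsupp, fun i j h => hbr' i j h.1 h.2.2.1,
    fun i hi => ?_⟩, ⟨⟨hsupp, hbr'⟩, hzneg _ (by omega), by rw [hzneg 0 le_rfl]; rfl⟩, hz0⟩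
  rcases le_or_gt i 0 with h0 | h0
  · rw [hzneg i h0, hzneg 0 le_rfl]
    simp
  rw [if_neg (by omega)]
  have : Nonempty (Fin p) := ⟨⟨0, by omega⟩⟩
  have hcomm := commute_pow_char_of_bracket hρbig hbr (i := i) (by omega)
  have hcomm' : ∀ n : ℕ, Commute (ρ i ^ p) (ρ (-1) ^ n) := fun n => Commute.pow_right hcomm n
  have hB : ∀ n : ℕ, n ≠ 0 → (vermaRho K p c lam' i ^ n) (vv p c 0) = 0 := by
    intro n hn
    obtain ⟨m, rfl⟩ := Nat.exists_eq_succ_of_ne_zero hn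
    rw [pow_succ, Module.End.mul_apply, vermaRho_vv_zero c lam' (by omega), if_neg (by omega),
      map_zero]
  have hgen : (ρ i ^ p) (0, vv p c 0) = 0 := by
    rw [blk_pow, blk_apply, hB p (by omega), map_zero, zero_add, LinearMap.sum_apply,
      Finset.sum_eq_single (p - 1)]
    · rw [Nat.sub_self, pow_zero, mul_one, Module.End.mul_apply, hz0, hP i (by omega)]
      rfl
    · intro k hk hk'
      have := Finset.mem_range.1 hk
      rw [Module.End.mul_apply, hB _ (by omega), map_zero]
    · intro h
      exact absurd (Finset.mem_range.2 (by omega)) h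
  refine lin_ext c fun n => ?_
  have h := LinearMap.congr_fun (hcomm' n).eq (0, vv p c 0)
  rw [Module.End.mul_apply, Module.End.mul_apply, hgen, map_zero, hpow2, blk_pow, blk_apply,
    map_zero, zero_add] at h
  exact congrArg Prod.fst h

theorem vermaRho_one_pow_uz (c lam : K) (hp : 3 ≤ p) {m : ℤ} (hm : m < p) (n : ℕ) :
    (vermaRho K p c lam 1 ^ n) (uz p c m)
      = (∏ k ∈ Finset.range n, (2 * lam - (m - k) + 1)) • uz p c (m - n) := by
  induction n with
  | zero => simp
  | succ n ih =>
    rw [pow_succ', Module.End.mul_apply, ih, map_smul,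
      vermaRho_uz c lam (by omega) (by omega) (by omega), smul_smul, Finset.prod_range_succ]
    congr 2
    · push_cast
      ring
    · push_cast
      ring

theorem vermaRho_pow_uz (c lam : K) {i : ℤ} (hi : 0 ≤ i) (hi' : i ≤ (p : ℤ) - 2) {m : ℤ}
    (hm : m < p) (n : ℕ) :
    ∃ t : K, (vermaRho K p c lam i ^ n) (uz p c m) = t • uz p c (m - n * i) := by
  induction n with
  | zero => exact ⟨1, by simp⟩
  | succ n ih =>
    obtain ⟨t, ht⟩ := ih
    have : 0 ≤ (n : ℤ) * i := by positivity
    rw [pow_succ', Module.End.mul_apply, ht, map_smul, vermaRho_uz c lam hi hi' (by omega),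
      smul_smul]
    exact ⟨_, by congr 2; push_cast; ring⟩

/-- The normalised cocycle with `e_j ↦ (v_0 ↦ a_j u_{D-j})`. -/
theorem exists_cocycle_of_coeff (c lam lam' : K) (hp : 3 ≤ p) (D : ℤ)
    (hD : (D : K) = lam - lam') (hD' : D ≤ p + 1) (a : ℤ → K) (ha0 : ∀ j ≤ 0, a j = 0)
    (ha1 : ∀ j, (p : ℤ) - 2 < j → a j = 0) (ha : D = p + 1 → a 1 = 0)
    (hR : ∀ i j : ℤ, 1 ≤ i → 1 ≤ j → i ≤ (p : ℤ) - 2 → j ≤ (p : ℤ) - 2 → i + j ≤ D →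
      ((j : K) - i) * a (i + j)
        = a j * (i * lam + lam' + i + j) - a i * (j * lam + lam' + i + j))
    (hP : D = p → ∃ k : ℕ, k < p - 1 ∧ 2 * lam + 2 + k = 0) :
    ∃ z ∈ cocycles K p (-1) (vermaRho K p c lam) (vermaRho K p c lam'),
      IsNorm c lam lam' z ∧ ∀ j, z j (vv p c 0) = a j • uz p c (D - j) := by
  have key : ∀ i j : ℤ, 0 ≤ i → i ≤ (p : ℤ) - 2 → vermaRho K p c lam i (a j • uz p c (D - j))
      = (a j * (i * lam + lam' + i + j)) • uz p c (D - (i + j)) := by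
    intro i j hi hi'
    by_cases haj : a j = 0
    · rw [haj, zero_smul, map_zero, zero_mul, zero_smul]
    have hj : 1 ≤ j := by
      by_contra h
      exact haj (ha0 j (by omega))
    have hj' : D - j < p := by
      by_contra h
      have h1 : D = p + 1 := by omega
      exact haj (by rw [show j = 1 by omega]; exact ha h1)
    rw [map_smul, vermaRho_uz c lam hi hi' hj', smul_smul]
    congr 2
    · push_cast
      rw [hD]
      ring
    · ring
  have hzero : ∀ i : ℤ, (p : ℤ) - 2 < i → vermaRho K p c lam i = 0 := fun i hi =>
    vermaRho_of_notMem c lam (Or.inr hi)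
  refine exists_cocycle c lam lam' (fun j => a j • uz p c (D - j)) (fun j hj => by simp [ha0 j hj])
    (fun j hj => by simp [ha1 j hj]) (fun i j hi hj => ?_) (fun j hj => ?_) (fun i hi => ?_)
  · rcases lt_or_ge ((p : ℤ) - 2) i with h | h
    · rw [hzero i h, ha1 i h, ha1 (i + j) (by omega)]
      simp
    rcases lt_or_ge ((p : ℤ) - 2) j with h' | h'
    · rw [hzero j h', ha1 j h', ha1 (i + j) (by omega)]
      simp
    rw [key i j (by omega) h, key j i (by omega) h', add_comm j i, ← sub_smul, smul_smul]
    rcases le_or_gt (i + j) D with h2 | h2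
    · rw [hR i j hi hj h h' h2]
      congr 1
      ring
    · rw [uz_of_neg c (by omega), smul_zero, smul_zero]
  · rw [key 0 j le_rfl (by omega), smul_smul, zero_add]
    congr 1
    push_cast
    ring
  · by_cases hai : a i = 0
    · rw [hai, zero_smul, map_zero]
    have hi' : i ≤ (p : ℤ) - 2 := by
      by_contra h
      exact hai (ha1 i (by omega))
    have hj' : D - i < p := by
      by_contra h
      have h1 : D = p + 1 := by omega
      exact hai (by rw [show i = 1 by omega]; exact ha h1)
    rw [map_smul]
    obtain ⟨t, ht⟩ := vermaRho_pow_uz c lam (by omega) hi' hj' (p - 1)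
    have hcast : (((p - 1 : ℕ) : ℤ)) = (p : ℤ) - 1 := by omega
    by_cases h : D - i - ((p - 1 : ℕ) : ℤ) * i < 0
    · rw [ht, uz_of_neg c h, smul_zero, smul_zero]
    · rw [hcast] at h
      have h1 : i = 1 := by nlinarith
      subst h1
      have hDp : D = p := by omega
      obtain ⟨k, hk, hk'⟩ := hP hDp
      rw [vermaRho_one_pow_uz c lam hp hj', Finset.prod_eq_zero (Finset.mem_range.2 hk), zero_smul,
        smul_zero]
      rw [hDp]
      push_cast
      rw [CharP.cast_eq_zero]
      linear_combination hk'

theorem finrank_ext_eq_zero {c lam lam' : K}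
    (h : ∀ z ∈ cocycles K p (-1) (vermaRho K p c lam) (vermaRho K p c lam'),
      ∃ f, z = bd p c lam lam' f) :
    Module.finrank K (extSpace K p (-1) (vermaRho K p c lam) (vermaRho K p c lam')) = 0 := by
  have : Subsingleton (extSpace K p (-1) (vermaRho K p c lam) (vermaRho K p c lam')) := by
    refine Submodule.Quotient.subsingleton_iff.2 (eq_top_iff.2 ?_)
    rintro ⟨z, hz⟩ -
    obtain ⟨f, hf⟩ := h z hz
    exact (mem_coboundaries_iff c lam lam' z).2 ⟨f, hf.symm⟩
  exact Module.finrank_zero_of_subsingleton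

theorem finrank_ext_eq_one {c lam lam' : K} {z : ℤ → Module.End K (Fin p → K)}
    (hz : z ∈ cocycles K p (-1) (vermaRho K p c lam) (vermaRho K p c lam'))
    (hz' : ∀ f, z ≠ bd p c lam lam' f)
    (h : ∀ w ∈ cocycles K p (-1) (vermaRho K p c lam) (vermaRho K p c lam'),
      ∃ t : K, ∃ f, w - bd p c lam lam' f = t • z) :
    Module.finrank K (extSpace K p (-1) (vermaRho K p c lam) (vermaRho K p c lam')) = 1 := by
  refine finrank_eq_one (Submodule.Quotient.mk ⟨z, hz⟩) ?_ ?_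
  · intro h0
    rw [Submodule.Quotient.mk_eq_zero] at h0
    obtain ⟨f, hf⟩ := (mem_coboundaries_iff c lam lam' z).1 h0
    exact hz' f hf.symm
  · intro w
    obtain ⟨⟨w, hw⟩, rfl⟩ := Submodule.Quotient.mk_surjective _ w
    obtain ⟨t, f, hf⟩ := h w hw
    refine ⟨t, ?_⟩
    rw [← Submodule.Quotient.mk_smul, eq_comm, Submodule.Quotient.eq]
    refine (mem_coboundaries_iff c lam lam' _).2 ⟨f, ?_⟩
    change bd p c lam lam' f = w - t • z
    rw [← hf, sub_sub_cancel]

/-- A normalised coboundary comes from an operator sending `v_0` to a multiple of `u_d`. -/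
theorem IsNorm.of_bd {c lam lam' : K} {f : Module.End K (Fin p → K)}
    (hf : IsNorm c lam lam' (bd p c lam lam' f)) {d : ℤ} (h0 : 0 ≤ d) (hd : d < p)
    (h : (d : K) = lam - lam') :
    ∃ t : K, ∀ j, 1 ≤ j → j ≤ (p : ℤ) - 2 → bd p c lam lam' f j (vv p c 0)
      = (t * (((j : K) + 1) * lam - d + j)) • uz p c (d - j) := by
  have h1 := hf.zero
  simp only [bd, LinearMap.sub_apply, Module.End.mul_apply, vermaRho_vv_zero c lam' le_rfl,
    if_true, map_smul] at h1
  obtain ⟨t, ht⟩ := exists_eq_smul_uz c h0 hd (x := f (vv p c 0)) fun i hi => by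
    have h2 := congrFun h1 i
    simp only [Pi.sub_apply, vermaRho_zero_apply, Pi.smul_apply, smul_eq_mul, Pi.zero_apply] at h2
    have h3 : ((d : K) - ((i : ℕ) : ℤ)) * f (vv p c 0) i = 0 := by
      rw [h]
      push_cast
      linear_combination h2
    rcases mul_eq_zero.1 h3 with h4 | h4
    · exact absurd (intCast_inj_of_lt (p := p) (sub_eq_zero.1 h4) (by omega) (by omega)).symm hi
    · exact h4
  refine ⟨t, fun j hj hj' => ?_⟩
  simp only [bd, LinearMap.sub_apply, Module.End.mul_apply, vermaRho_vv_zero c lam' (j := j)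
    (by omega), if_neg (show j ≠ 0 by omega), map_zero, sub_zero, ht, map_smul,
    vermaRho_uz c lam (by omega) hj' hd, smul_smul]

theorem isNorm_bd_of_commuting {c lam lam' : K} {f : Module.End K (Fin p → K)} {d : ℤ}
    (hd : d < p) (h : (d : K) = lam - lam') {t : K} (hf : f (vv p c 0) = t • uz p c d)
    (hf' : bd p c lam lam' f (-1) = 0) : IsNorm c lam lam' (bd p c lam lam' f) := by
  have h2 : (2 : ℤ) ≤ p := by exact_mod_cast hpr.out.two_le
  refine ⟨isBr_bd _ _ _ _, hf', ?_⟩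
  simp only [bd, LinearMap.sub_apply, Module.End.mul_apply, vermaRho_vv_zero c lam' le_rfl,
    if_true, map_smul, hf, vermaRho_uz c lam le_rfl (show 0 ≤ (p : ℤ) - 2 by omega) hd, h,
    Int.cast_zero, sub_zero]
  rw [smul_comm t, ← sub_smul, smul_smul]
  ring_nf
  simp

/-- Normalisation when `e_1 u_d ≠ 0`. -/
theorem exists_isNorm_one_eq_zero (hp : 3 ≤ p) {c lam lam' : K} {d : ℤ} (h0 : 1 ≤ d) (hd : d < p)
    (h : (d : K) = lam - lam') (hs : lam + lam' + 1 ≠ 0) {z : ℤ → Module.End K (Fin p → K)}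
    (hz : z ∈ cocycles K p (-1) (vermaRho K p c lam) (vermaRho K p c lam')) :
    ∃ f, IsNorm c lam lam' (z - bd p c lam lam' f) ∧
      (z - bd p c lam lam' f) 1 (vv p c 0) = 0 := by
  obtain ⟨f, hf⟩ := exists_isNorm (by omega) hd h hz
  obtain ⟨b, hb⟩ := hf.exists_eq_smul (j := 1) (m := d - 1) le_rfl (by omega) (by omega)
    (by push_cast; rw [h])
  obtain ⟨g, hg, hg'⟩ := exists_commuting c lam lam' ((b / (lam + lam' + 1)) • uz p c d)
  have hgn := isNorm_bd_of_commuting hd h hg hg'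
  refine ⟨f + g, ?_, ?_⟩
  · rw [bd_add, ← sub_sub]
    exact hf.sub hgn
  · rw [bd_add, ← sub_sub, Pi.sub_apply, LinearMap.sub_apply, hb]
    simp only [bd, LinearMap.sub_apply, Module.End.mul_apply, vermaRho_vv_zero c lam' (j := 1)
      (by omega), if_neg (one_ne_zero (α := ℤ)), map_zero, sub_zero, hg, map_smul,
      vermaRho_uz c lam (j := 1) (by omega) (by omega) hd, smul_smul]
    rw [← sub_smul]
    convert zero_smul K _
    rw [h]
    field_simp
    push_cast
    ring

theorem IsNorm.chain {c lam lam' : K} {z : ℤ → Module.End K (Fin p → K)}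
    (hz : IsNorm c lam lam' z) (h1 : z 1 (vv p c 0) = 0) (n : ℕ) :
    (vermaRho K p c lam 1 ^ n) (z 2 (vv p c 0)) = (n.factorial : K) • z (n + 2) (vv p c 0) := by
  induction n with
  | zero => simp
  | succ n ih =>
    have h2 := hz.br_vv_zero (i := 1) (j := n + 2) le_rfl (by omega)
    rw [h1, map_zero, sub_zero] at h2
    rw [pow_succ', Module.End.mul_apply, ih, map_smul, ← h2, smul_smul, Nat.factorial_succ]
    congr 2
    · push_cast
      ring
    · congr 1
      push_cast
      ring

theorem finrank_ext_eq_one_of_one_ne_zero (hp : 5 ≤ p) {c lam lam' : K} {d m₁ m₂ : ℤ}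
    (h0 : 0 ≤ d) (hd : d < p) (h : (d : K) = lam - lam') (hs : d = 0 ∨ lam + lam' + 1 = 0)
    (h1 : 0 ≤ m₁) (h1' : m₁ < p) (hm₁ : (m₁ : K) = lam - lam' - 1)
    (h2 : (p : ℤ) - 3 ≤ m₂) (h2' : m₂ < p) (hm₂ : (m₂ : K) = lam - lam' - 2)
    (hm : ∀ i : ℤ, m₂ - (p - 3) < i → i ≤ m₂ → 2 * lam + 1 - i ≠ 0)
    {z : ℤ → Module.End K (Fin p → K)}
    (hz : z ∈ cocycles K p (-1) (vermaRho K p c lam) (vermaRho K p c lam'))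
    (hzn : IsNorm c lam lam' z) {a : K} (ha : a ≠ 0) (hza : z 1 (vv p c 0) = a • uz p c m₁) :
    Module.finrank K (extSpace K p (-1) (vermaRho K p c lam) (vermaRho K p c lam')) = 1 := by
  refine finrank_ext_eq_one hz ?_ ?_
  · rintro f rfl
    obtain ⟨t, ht⟩ := hzn.of_bd h0 hd h
    have h3 := ht 1 le_rfl (by omega)
    rw [hza] at h3
    have h4 : (t * ((((1 : ℤ) : K) + 1) * lam - d + (1 : ℤ))) • uz p c (d - 1) = 0 := by
      rcases hs with rfl | hs
      · rw [uz_of_neg c (by omega), smul_zero]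
      · convert zero_smul K _
        rw [h]
        push_cast
        linear_combination t * hs
    rw [h4] at h3
    exact (smul_ne_zero ha (uz_ne_zero c h1 h1')) h3
  · intro w hw
    obtain ⟨f, hf⟩ := exists_isNorm h0 hd h hw
    obtain ⟨b, hb⟩ := hf.exists_eq_smul (j := 1) le_rfl h1 h1' (by rw [hm₁]; simp)
    refine ⟨b / a, f, sub_eq_zero.1 ?_⟩
    have hn := hf.sub (hzn.smul (b / a))
    have hn1 : (w - bd p c lam lam' f - (b / a) • z) 1 (vv p c 0) = 0 := by
      rw [Pi.sub_apply, LinearMap.sub_apply, hb, Pi.smul_apply, LinearMap.smul_apply, hza,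
        smul_smul, div_mul_cancel₀ b ha, sub_self]
    refine hn.eq_zero hn1 ?_
    obtain ⟨b₂, hb₂⟩ := hn.exists_eq_smul (j := 2) (by omega) (by omega) h2' (by rw [hm₂]; simp)
    have h3 := hn.chain hn1 (p - 3)
    rw [hb₂, map_smul, vermaRho_one_pow_uz c lam (by omega) h2', smul_smul, hn.isBr.supp _ (by
      right; omega), LinearMap.zero_apply, smul_zero] at h3
    have h4 := (smul_eq_zero.1 h3).resolve_right (uz_ne_zero c (by omega) (by omega))
    rw [hb₂, (mul_eq_zero.1 h4).resolve_right, zero_smul]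
    refine Finset.prod_ne_zero_iff.2 fun k hk => ?_
    have hk' := Finset.mem_range.1 hk
    have := hm (m₂ - k) (by omega) (by omega)
    convert this using 1
    push_cast
    ring

theorem finrank_ext_eq_one_of_two_ne_zero (hp : 5 ≤ p) {c lam lam' : K} {d m : ℤ}
    (h0 : 1 ≤ d) (hd : d < p) (h : (d : K) = lam - lam') (hs : lam + lam' + 1 ≠ 0)
    (h1 : 0 ≤ m) (h1' : m < p) (hm : (m : K) = lam - lam' - 2)
    {z : ℤ → Module.End K (Fin p → K)}
    (hz : z ∈ cocycles K p (-1) (vermaRho K p c lam) (vermaRho K p c lam'))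
    (hzn : IsNorm c lam lam' z) (hz1 : z 1 (vv p c 0) = 0)
    {a : K} (ha : a ≠ 0) (hza : z 2 (vv p c 0) = a • uz p c m) :
    Module.finrank K (extSpace K p (-1) (vermaRho K p c lam) (vermaRho K p c lam')) = 1 := by
  refine finrank_ext_eq_one hz ?_ ?_
  · rintro f rfl
    obtain ⟨t, ht⟩ := hzn.of_bd (by omega) hd h
    have h3 := ht 1 le_rfl (by omega)
    rw [hz1, eq_comm, smul_eq_zero] at h3
    have h4 := (mul_eq_zero.1 (h3.resolve_right (uz_ne_zero c (by omega) (by omega)))).resolve_right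
      (by
        convert hs using 2
        rw [h]
        push_cast
        ring)
    have h5 := ht 2 (by omega) (by omega)
    rw [hza, h4, zero_mul, zero_smul] at h5
    exact (smul_ne_zero ha (uz_ne_zero c h1 h1')) h5
  · intro w hw
    obtain ⟨f, hf, hf1⟩ := exists_isNorm_one_eq_zero (by omega) h0 hd h hs hw
    obtain ⟨b, hb⟩ := hf.exists_eq_smul (j := 2) (by omega) h1 h1' (by rw [hm]; simp)
    refine ⟨b / a, f, sub_eq_zero.1 ((hf.sub (hzn.smul (b / a))).eq_zero ?_ ?_)⟩
    · rw [Pi.sub_apply, LinearMap.sub_apply, hf1, Pi.smul_apply, LinearMap.smul_apply, hz1,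
        smul_zero, sub_zero]
    · rw [Pi.sub_apply, LinearMap.sub_apply, hb, Pi.smul_apply, LinearMap.smul_apply, hza,
        smul_smul, div_mul_cancel₀ b ha, sub_self]

theorem finrank_ext_eq_zero_of_degree_five (hp : 5 ≤ p) {c lam lam' : K} {d : ℤ}
    (h0 : 5 ≤ d) (hd : d < p) (h : (d : K) = lam - lam') (hs : lam + lam' + 1 ≠ 0)
    (hq : (lam + lam' + 3) * (lam + lam' + 4) * (lam + lam' + 5)
      - 6 * ((lam + lam' + 3) * (2 * lam + lam' + 5) - (3 * lam + lam' + 5)) ≠ 0) :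
    Module.finrank K (extSpace K p (-1) (vermaRho K p c lam) (vermaRho K p c lam')) = 0 := by
  refine finrank_ext_eq_zero fun w hw => ?_
  obtain ⟨f, hf, hf1⟩ := exists_isNorm_one_eq_zero (by omega) (by omega) hd h hs hw
  refine ⟨f, sub_eq_zero.1 (hf.eq_zero hf1 ?_)⟩
  set z := w - bd p c lam lam' f
  obtain ⟨b, hb⟩ := hf.exists_eq_smul (j := 2) (m := d - 2) (by omega) (by omega) (by omega)
    (by push_cast; rw [h])
  have h3 := hf.chain hf1 1
  have h5 := hf.chain hf1 3
  have h5' := hf.br_vv_zero (i := 2) (j := 3) (by omega) (by omega)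
  rw [hb, map_smul, vermaRho_one_pow_uz c lam (by omega) (by omega), smul_smul] at h3 h5
  have e3 : z 3 (vv p c 0) = (b * (lam + lam' + 3)) • uz p c (d - 3) := by
    have : z 3 (vv p c 0) = (Nat.factorial 1 : K) • z ((1 : ℕ) + 2) (vv p c 0) := by simp
    rw [this, ← h3]
    congr 2
    · simp [h]
      ring
    · push_cast
      ring
  have e5 : (6 : K) • z 5 (vv p c 0)
      = (b * ((lam + lam' + 3) * (lam + lam' + 4) * (lam + lam' + 5))) • uz p c (d - 5) := by
    have : (6 : K) • z 5 (vv p c 0) = (Nat.factorial 3 : K) • z ((3 : ℕ) + 2) (vv p c 0) := by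
      simp [Nat.factorial]
    rw [this, ← h5]
    congr 2
    · simp [Finset.prod_range_succ, h]
      ring
    · push_cast
      ring
  rw [e3, hb, map_smul, map_smul, vermaRho_uz c lam (by omega) (by omega) (by omega),
    vermaRho_uz c lam (by omega) (by omega) (by omega), smul_smul, smul_smul,
    show d - 3 - 2 = d - 5 by ring, show d - 2 - 3 = d - 5 by ring, ← sub_smul] at h5'
  have h6 : (6 : K) • z 5 (vv p c 0) = (6 : K) • ((((3 : ℤ) : K) - (2 : ℤ)) • z (2 + 3) (vv p c 0)) := by
    norm_num
  rw [h5', e5, smul_smul, ← sub_eq_zero, ← sub_smul] at h6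
  have h7 := (smul_eq_zero.1 h6).resolve_right (uz_ne_zero c (by omega) (by omega))
  have h8 : b * ((lam + lam' + 3) * (lam + lam' + 4) * (lam + lam' + 5)
      - 6 * ((lam + lam' + 3) * (2 * lam + lam' + 5) - (3 * lam + lam' + 5))) = 0 := by
    rw [← h7]
    push_cast
    rw [h]
    ring
  rw [hb, (mul_eq_zero.1 h8).resolve_right hq, zero_smul]

theorem add_one_eq_zero_of_neg_one {i : ℤ} (h : (-1 : K) - i = 0) (h0 : 0 < i + 1)
    (h1 : i + 1 < p) : False :=
  intCast_ne_zero_of_lt (K := K) (p := p) h0 h1 (by push_cast; linear_combination -h)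

theorem sub_one_eq_zero_of_one {i : ℤ} (h : (1 : K) - i = 0) (h0 : 0 < i - 1)
    (h1 : i - 1 < p) : False :=
  intCast_ne_zero_of_lt (K := K) (p := p) h0 h1 (by push_cast; linear_combination -h)

theorem natCast_ne_zero_of_lt {n : ℕ} (h : 0 < n) (h1 : n < p) : (n : K) ≠ 0 := by
  have := intCast_ne_zero_of_lt (K := K) (p := p) (a := n) (by omega) (by omega)
  exact_mod_cast this

/-- Cocycles with polynomial coefficients, truncated to the admissible range. -/
theorem exists_cocycle_of_poly (c lam lam' : K) (hp : 5 ≤ p) (D : ℤ)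
    (hD : (D : K) = lam - lam') (hD' : D ≤ p + 1) (q : K → K)
    (hq : ∀ j : ℤ, (p : ℤ) - 1 ≤ j → j ≤ D → q j = 0) (hq1 : D = p + 1 → q 1 = 0)
    (hR : ∀ i j : ℤ, ((j : K) - i) * q (i + j)
        = q j * (i * lam + lam' + i + j) - q i * (j * lam + lam' + i + j))
    (hP : D = p → ∃ k : ℕ, k < p - 1 ∧ 2 * lam + 2 + k = 0) :
    ∃ z ∈ cocycles K p (-1) (vermaRho K p c lam) (vermaRho K p c lam'),
      IsNorm c lam lam' z ∧ z 1 (vv p c 0) = q 1 • uz p c (D - 1) ∧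
        z 2 (vv p c 0) = q 2 • uz p c (D - 2) := by
  obtain ⟨z, hz, hzn, hza⟩ := exists_cocycle_of_coeff c lam lam' (by omega) D hD hD'
    (fun j => if 1 ≤ j ∧ j ≤ (p : ℤ) - 2 then q j else 0) (fun j hj => if_neg (by omega))
    (fun j hj => if_neg (by omega)) (fun h => by simp [hq1 h]) (fun i j hi hj hi' hj' hij => by
      simp only [hi, hj, hi', hj', and_self, if_true]
      rw [← hR i j]
      split_ifs with h
      · push_cast
        rfl
      · have := hq (i + j) (by omega) hij
        push_cast at this
        rw [this]) hP
  refine ⟨z, hz, hzn, ?_, ?_⟩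
  · rw [hza, if_pos (by omega), Int.cast_one]
  · rw [hza, if_pos (by omega), Int.cast_ofNat]

theorem finrank_ext_zero_zero (hp : 5 ≤ p) (c : K) :
    Module.finrank K (extSpace K p (-1) (vermaRho K p c 0) (vermaRho K p c 0)) = 1 := by
  obtain ⟨z, hz, hzn, hz1, -⟩ := exists_cocycle_of_poly c 0 0 hp p (by simp) (by omega)
    (fun j => j * (j + 1)) (fun j hj hj' => by
      rcases (show j = (p : ℤ) - 1 ∨ j = p by omega) with rfl | rfl <;> simp) (by omega)
    (fun i j => by ring) (fun _ => ⟨p - 2, by omega, by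
      rw [Nat.cast_sub (by omega)]
      simp⟩)
  refine finrank_ext_eq_one_of_one_ne_zero hp (d := 0) (m₁ := p - 1) (m₂ := p - 2) le_rfl
    (by omega) (by simp) (Or.inl rfl) (by omega) (by omega) (by simp) (by omega) (by omega)
    (by simp) (fun i hi hi' h => ?_) hz hzn ?_ hz1
  · exact sub_one_eq_zero_of_one (K := K) (p := p) (i := i) (by linear_combination h) (by omega)
      (by omega)
  · have := natCast_ne_zero_of_lt (K := K) (p := p) (n := 2) (by omega) (by omega)
    push_cast at this
    convert this using 1
    ring

theorem finrank_ext_neg_one_zero (hp : 5 ≤ p) (c : K) :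
    Module.finrank K (extSpace K p (-1) (vermaRho K p c (-1)) (vermaRho K p c 0)) = 1 := by
  obtain ⟨z, hz, hzn, hz1, -⟩ := exists_cocycle_of_poly c (-1) 0 hp (p - 1) (by simp) (by omega)
    (fun j => j + 1) (fun j hj hj' => by
      rw [show j = (p : ℤ) - 1 by omega]
      simp) (by omega) (fun i j => by ring) (by omega)
  refine finrank_ext_eq_one_of_one_ne_zero hp (d := p - 1) (m₁ := p - 1 - 1) (m₂ := p - 3)
    (by omega) (by omega) (by simp) (Or.inr (by ring)) (by omega) (by omega) (by simp) (by omega)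
    (by omega) (by simp; ring) (fun i hi hi' h => ?_) hz hzn ?_ hz1
  · exact add_one_eq_zero_of_neg_one (K := K) (p := p) (i := i) (by linear_combination h)
      (by omega) (by omega)
  · have := natCast_ne_zero_of_lt (K := K) (p := p) (n := 2) (by omega) (by omega)
    push_cast at this
    convert this using 1
    ring

theorem finrank_ext_one_zero (hp : 5 ≤ p) (c : K) :
    Module.finrank K (extSpace K p (-1) (vermaRho K p c 1) (vermaRho K p c 0)) = 1 := by
  obtain ⟨z, hz, hzn, hz1, hz2⟩ := exists_cocycle_of_poly c 1 0 hp (p + 1) (by simp) (by omega)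
    (fun j => j * (j * j - 1)) (fun j hj hj' => by
      rcases (show j = (p : ℤ) - 1 ∨ j = p ∨ j = p + 1 by omega) with rfl | rfl | rfl <;> simp)
    (fun _ => by ring) (fun i j => by ring) (by omega)
  refine finrank_ext_eq_one_of_two_ne_zero hp (d := 1) (m := p + 1 - 2) le_rfl (by omega)
    (by simp) ?_ (by omega) (by omega) (by simp) hz hzn ?_ ?_ hz2
  · have := natCast_ne_zero_of_lt (K := K) (p := p) (n := 2) (by omega) (by omega)
    push_cast at this
    convert this using 1
    ring
  · rw [hz1]
    simp
  · have h2 := natCast_ne_zero_of_lt (K := K) (p := p) (n := 2) (by omega) (by omega)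
    have h3 := natCast_ne_zero_of_lt (K := K) (p := p) (n := 3) (by omega) (by omega)
    push_cast at h2 h3
    convert mul_ne_zero h2 h3 using 1
    ring

/-- The cocycle concentrated in degree one. -/
theorem exists_cocycle_single (c lam lam' : K) (hp : 5 ≤ p) (D : ℤ)
    (hD : (D : K) = lam - lam') (hD' : D ≤ p)
    (hR : ∀ j : ℤ, 1 < j → j + 1 ≤ D → j * lam + lam' + 1 + j = 0)
    (hP : D = p → ∃ k : ℕ, k < p - 1 ∧ 2 * lam + 2 + k = 0) :
    ∃ z ∈ cocycles K p (-1) (vermaRho K p c lam) (vermaRho K p c lam'),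
      IsNorm c lam lam' z ∧ z 1 (vv p c 0) = (1 : K) • uz p c (D - 1) := by
  obtain ⟨z, hz, hzn, hza⟩ := exists_cocycle_of_coeff c lam lam' (by omega) D hD (by omega)
    (fun j => if j = 1 then 1 else 0) (fun j hj => if_neg (by omega))
    (fun j hj => if_neg (by omega)) (by omega) (fun i j hi hj hi' hj' hij => by
      rw [if_neg (show i + j ≠ 1 by omega), mul_zero]
      by_cases h1 : i = 1 <;> by_cases h2 : j = 1
      · rw [h1, h2]
        ring
      · rw [if_neg h2, if_pos h1, h1]
        have := hR j (by omega) (by omega)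
        push_cast
        linear_combination this
      · rw [if_neg h1, if_pos h2, h2]
        have := hR i (by omega) (by omega)
        push_cast
        linear_combination -this
      · rw [if_neg h1, if_neg h2]
        ring) hP
  exact ⟨z, hz, hzn, by rw [hza, if_pos rfl]⟩

theorem finrank_ext_zero_neg_one (hp : 5 ≤ p) (c : K) :
    Module.finrank K (extSpace K p (-1) (vermaRho K p c 0) (vermaRho K p c (-1))) = 1 := by
  obtain ⟨z, hz, hzn, hz1⟩ := exists_cocycle_single c 0 (-1) hp 1 (by simp) (by omega)
    (by omega) (by omega)
  refine finrank_ext_eq_one_of_one_ne_zero hp (d := 1) (m₁ := 1 - 1) (m₂ := p - 1) (by omega)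
    (by omega) (by simp) (Or.inr (by ring)) (by omega) (by omega) (by simp) (by omega) (by omega)
    (by simp; ring) (fun i hi hi' h => ?_) hz hzn one_ne_zero hz1
  exact sub_one_eq_zero_of_one (K := K) (p := p) (i := i) (by linear_combination h) (by omega)
    (by omega)

theorem finrank_ext_neg_one_neg_one (hp : 5 ≤ p) (c : K) :
    Module.finrank K (extSpace K p (-1) (vermaRho K p c (-1)) (vermaRho K p c (-1))) = 1 := by
  obtain ⟨z, hz, hzn, hz1⟩ := exists_cocycle_single c (-1) (-1) hp p (by simp) le_rfl
    (fun j _ _ => by ring) (fun _ => ⟨0, by omega, by simp⟩)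
  refine finrank_ext_eq_one_of_one_ne_zero hp (d := 0) (m₁ := p - 1) (m₂ := p - 2) le_rfl
    (by omega) (by simp) (Or.inl rfl) (by omega) (by omega) (by simp) (by omega) (by omega)
    (by simp) (fun i hi hi' h => ?_) hz hzn one_ne_zero hz1
  exact add_one_eq_zero_of_neg_one (K := K) (p := p) (i := i) (by linear_combination h) (by omega)
    (by omega)

/-- Cocycles starting in degree two and ending in degree at most five. -/
theorem finrank_ext_eq_one_of_short (hp : 5 ≤ p) (c : K) {lam lam' : K} {d : ℤ} (h0 : 2 ≤ d)
    (h5 : d ≤ 5) (hd : d < p) (h : (d : K) = lam - lam') (hs : lam + lam' + 1 ≠ 0) (a₃ a₄ a₅ : K)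
    (h₃ : 3 ≤ d → a₃ = lam + lam' + 3) (h₄ : 4 ≤ d → 2 * a₄ = a₃ * (lam + lam' + 4))
    (h₅ : 5 ≤ d → 3 * a₅ = a₄ * (lam + lam' + 5) ∧
      a₅ = a₃ * (2 * lam + lam' + 5) - (3 * lam + lam' + 5))
    (h₄' : p = 5 → a₄ = 0) (h₅' : p = 5 → a₅ = 0) :
    Module.finrank K (extSpace K p (-1) (vermaRho K p c lam) (vermaRho K p c lam')) = 1 := by
  have hp6 : p ≠ 6 := fun h6 => by
    have := hpr.out
    rw [h6] at this
    exact absurd this (by decide)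
  let a : ℤ → K := fun j =>
    if j = 2 then 1 else if j = 3 then a₃ else if j = 4 then a₄ else if j = 5 then a₅ else 0
  obtain ⟨z, hz, hzn, hza⟩ := exists_cocycle_of_coeff c lam lam' (by omega) d h (by omega) a
    (fun j hj => by
      simp only [a]
      rw [if_neg (by omega), if_neg (by omega), if_neg (by omega), if_neg (by omega)])
    (fun j hj => by
      simp only [a]
      rw [if_neg (by omega), if_neg (by omega)]
      split_ifs with h1 h2
      · exact h₄' (by omega)
      · exact h₅' (by omega)
      · rfl) (by omega) (fun i j hi hj hi' hj' hij => by
      have hi5 : i ≤ 4 := by omega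
      have hj5 : j ≤ 4 := by omega
      interval_cases i <;> interval_cases j <;> first
        | (exfalso; omega)
        | (norm_num [a]; done)
        | (have e3 := h₃ (by omega)
           norm_num [a]
           linear_combination e3)
        | (have e3 := h₃ (by omega)
           norm_num [a]
           linear_combination -e3)
        | (have e4 := h₄ (by omega)
           norm_num [a]
           linear_combination e4)
        | (have e4 := h₄ (by omega)
           norm_num [a]
           linear_combination -e4)
        | (have e5 := (h₅ (by omega)).1
           norm_num [a]
           linear_combination e5)
        | (have e5 := (h₅ (by omega)).1
           norm_num [a]
           linear_combination -e5)
        | (have e5 := (h₅ (by omega)).2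
           norm_num [a]
           linear_combination e5)
        | (have e5 := (h₅ (by omega)).2
           norm_num [a]
           linear_combination -e5)) (by omega)
  refine finrank_ext_eq_one_of_two_ne_zero hp (d := d) (m := d - 2) (by omega) hd h hs (by omega)
    (by omega) (by push_cast; rw [h]) hz hzn ?_ one_ne_zero ?_
  · rw [hza]
    simp [a]
  · rw [hza]
    simp [a]

theorem exists_natCast_eq {lam : K} (h : lam ^ p = lam) : ∃ l : ℕ, l < p ∧ lam = l := by
  have hle : (⊥ : Subfield K) ≤ (ZMod.castHom (dvd_refl p) K).fieldRange := bot_le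
  obtain ⟨x, rfl⟩ := hle ((Subfield.mem_bot_iff_pow_eq_self K p).2 h)
  refine ⟨x.val, x.val_lt, ?_⟩
  rw [ZMod.castHom_apply, ZMod.natCast_val]

theorem natCast_inj_of_lt {m n : ℕ} (hm : m < p) (hn : n < p) : (m : K) = n ↔ m = n := by
  refine ⟨fun h => ?_, fun h => by rw [h]⟩
  have h' : ((m : ℤ) : K) = ((n : ℤ) : K) := by exact_mod_cast h
  have := intCast_inj_of_lt (p := p) h' (by omega) (by omega)
  omega

theorem finrank_ext_natCast (hp : 5 ≤ p) (c : K) {lam' : K} (hl' : lam' = 0 ∨ lam' = -1) {l : ℕ}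
    (hl : l < p) :
    Module.finrank K (extSpace K p (-1) (vermaRho K p c l) (vermaRho K p c lam')) =
      if l = 0 ∨ l = 1 ∨ l = 2 ∨ l = 3 ∨ l = 4 ∨ l = p - 1 then 1 else 0 := by
  have hp6 : p ≠ 6 := fun h6 => by
    have := hpr.out
    rw [h6] at this
    exact absurd this (by decide)
  have hne : ∀ n : ℕ, 0 < n → n < p → (n : K) ≠ 0 := fun n => natCast_ne_zero_of_lt
  by_cases h1 : l = p - 1
  · have hc : (l : K) = -1 := by
      rw [h1, Nat.cast_sub (by omega)]
      simp
    rw [if_pos (by omega), hc]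
    rcases hl' with rfl | rfl
    · exact finrank_ext_neg_one_zero hp c
    · exact finrank_ext_neg_one_neg_one hp c
  by_cases h5 : 5 ≤ l
  · rw [if_neg (by omega)]
    have a0 := hne l (by omega) (by omega)
    have a1 := hne (l - 1) (by omega) (by omega)
    have a4 := hne (l - 4) (by omega) (by omega)
    have b1 := hne (l + 1) (by omega) (by omega)
    rw [Nat.cast_sub (by omega)] at a1 a4
    push_cast at a1 a4 b1
    rcases hl' with rfl | rfl
    · refine finrank_ext_eq_zero_of_degree_five hp (d := l) (by omega) (by omega) (by simp)
        (by rwa [add_zero]) ?_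
      convert mul_ne_zero a0 (mul_ne_zero a1 b1) using 1
      ring
    · refine finrank_ext_eq_zero_of_degree_five hp (d := l + 1) (by omega) (by omega) (by simp)
        (by rwa [neg_add_cancel_right]) ?_
      convert mul_ne_zero a0 (mul_ne_zero a4 b1) using 1
      ring
  rw [if_pos (by omega)]
  have h2 := hne 2 (by omega) (by omega)
  have h3 := hne 3 (by omega) (by omega)
  have h4 := hne 4 (by omega) (by omega)
  push_cast at h2 h3 h4
  have hl5 : l < 5 := by omega
  rcases hl' with rfl | rfl
  · interval_cases l
    · rw [Nat.cast_zero]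
      exact finrank_ext_zero_zero hp c
    · rw [Nat.cast_one]
      exact finrank_ext_one_zero hp c
    · refine finrank_ext_eq_one_of_short hp c (d := 2) (by omega) (by omega) (by omega) (by simp)
        ?_ 0 0 0 (by omega) (by omega) (by omega) (fun _ => rfl) (fun _ => rfl)
      convert h3 using 1
      norm_num
    · refine finrank_ext_eq_one_of_short hp c (d := 3) (by omega) (by omega) (by omega) (by simp)
        ?_ 6 0 0 (fun _ => by norm_num) (by omega) (by omega) (fun _ => rfl) (fun _ => rfl)
      convert h4 using 1
      norm_num
    · refine finrank_ext_eq_one_of_short hp c (d := 4) (by omega) (by omega) (by omega) (by simp)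
        ?_ 7 28 0 (fun _ => by norm_num) (fun _ => by norm_num) (by omega) (by omega) (by omega)
      convert hne 5 (by omega) (by omega) using 1
      norm_num
  · interval_cases l
    · rw [Nat.cast_zero]
      exact finrank_ext_zero_neg_one hp c
    · refine finrank_ext_eq_one_of_short hp c (d := 2) (by omega) (by omega) (by omega)
        (by norm_num) ?_ 0 0 0 (by omega) (by omega) (by omega) (fun _ => rfl) (fun _ => rfl)
      norm_num
    · refine finrank_ext_eq_one_of_short hp c (d := 3) (by omega) (by omega) (by omega)
        (by norm_num) ?_ 4 0 0 (fun _ => by norm_num) (by omega) (by omega) (fun _ => rfl)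
        (fun _ => rfl)
      convert h2 using 1
      norm_num
    · refine finrank_ext_eq_one_of_short hp c (d := 4) (by omega) (by omega) (by omega)
        (by norm_num) ?_ 5 15 0 (fun _ => by norm_num) (fun _ => by norm_num) (by omega)
        (fun h => ?_) (fun _ => rfl)
      · convert h3 using 1
        norm_num
      · have : ((5 : ℕ) : K) = 0 := by rw [← h, CharP.cast_eq_zero]
        push_cast at this
        linear_combination 3 * this
    · refine finrank_ext_eq_one_of_short hp c (d := 5) (by omega) (by omega) (by omega)
        (by norm_num) ?_ 6 21 56 (fun _ => by norm_num) (fun _ => by norm_num)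
        (fun _ => ⟨by norm_num, by norm_num⟩) (by omega) (by omega)
      convert h4 using 1
      norm_num

end WittExt

open scoped Classical in
/-- If `χ` has height `-1`, `0` or `1`, `λ, λ' ∈ Λ(χ)` and `λ' ∈ {0, p-1}`, then
`Ext(V_χ(λ'), V_χ(λ)) ≅ K` if `λ ∈ {0,1,2,3,4,p-1}` and `Ext(V_χ(λ'), V_χ(λ)) = 0` otherwise. -/
theorem ext_verma_verma_of_lambda'_mem
    (K : Type) [Field K] [IsAlgClosed K] (p : ℕ) [CharP K p] (hp : 3 < p)
    (chi : ℤ → K) (hsupp : ∀ k : ℤ, (k < -1 ∨ (p : ℤ) - 2 < k) → chi k = 0)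
    (hheight : ∀ k : ℤ, 1 ≤ k → chi k = 0)
    (lam lam' : K)
    (hlam : lam ^ p - lam = chi 0 ^ p) (hlam' : lam' ^ p - lam' = chi 0 ^ p)
    (hl' : lam' = 0 ∨ lam' = (p : K) - 1) :
    Module.finrank K (extSpace K p (-1)
        (vermaRho K p (chi (-1) ^ p) lam) (vermaRho K p (chi (-1) ^ p) lam'))
      = if lam = 0 ∨ lam = 1 ∨ lam = 2 ∨ lam = 3 ∨ lam = 4 ∨ lam = (p : K) - 1
        then 1 else 0 := by
  have hprime : p.Prime := (CharP.char_is_prime_or_zero K p).resolve_right (by omega)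
  have : Fact p.Prime := ⟨hprime⟩
  have hp5 : 5 ≤ p := by
    have h4 : p ≠ 4 := fun h => by
      rw [h] at hprime
      exact absurd hprime (by decide)
    omega
  have hc : (p : K) - 1 = -1 := by simp
  rw [hc] at hl' ⊢
  have hneg : (-1 : K) ^ p = -1 := (hprime.odd_of_ne_two (by omega)).neg_one_pow
  have h0 : lam' ^ p - lam' = 0 := by
    rcases hl' with rfl | rfl
    · rw [zero_pow (by omega), sub_zero]
    · rw [hneg, sub_self]
  rw [← hlam', h0, sub_eq_zero] at hlam
  obtain ⟨l, hl, rfl⟩ := WittExt.exists_natCast_eq hlam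
  rw [WittExt.finrank_ext_natCast hp5 _ hl' hl]
  have hiff : ∀ n : ℕ, n < p → ((l : K) = n ↔ l = n) := fun n =>
    WittExt.natCast_inj_of_lt hl
  have e0 := hiff 0 (by omega)
  have e1 := hiff 1 (by omega)
  have e2 := hiff 2 (by omega)
  have e3 := hiff 3 (by omega)
  have e4 := hiff 4 (by omega)
  have e5 := hiff (p - 1) (by omega)
  rw [Nat.cast_sub (by omega)] at e5
  push_cast at e0 e1 e2 e3 e4 e5
  rw [hc] at e5
  simp only [e0, e1, e2, e3, e4, e5]
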